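/- arXiv:1407.8479 — 3 statements merged into one kernel-verified Lean document; each statement's English description precedes it below -/
import Mathlib

section
/- Let μ be a nonnegative Borel measure on the quaternionic unit ball 𝔹. Then μ is a Carleson measure for the Hardy space H²(𝔹) if and only if there exists a constant C such that μ(S(q)) ≤ C·(1 − |q|) for every q ∈ 𝔹 with q ≠ 0. -/
open scoped Quaternion ENNReal
open MeasureTheory

noncomputable instance : MeasurableSpace ℍ[ℝ] := borel ℍ[ℝ]
instance : BorelSpace ℍ[ℝ] := ⟨rfl⟩

/-- `ϱ e^{Iα} = ϱ(cos α + I sin α)` for an imaginary unit `I`. -/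
noncomputable def expQ (I : ℍ[ℝ]) (θ : ℝ) : ℍ[ℝ] := Real.cos θ • (1 : ℍ[ℝ]) + Real.sin θ • I

/-- The angle `θ ∈ [0,π]` of `q = r e^{Jθ}`. -/
noncomputable def thetaOf (q : ℍ[ℝ]) : ℝ := Real.arccos (q.re / ‖q‖)

/-- The symmetric box `S(q)` of the quaternionic unit ball indexed by `q = r e^{Jθ}`:
all points `ϱ e^{Iα} ∈ 𝔹` with `I` any imaginary unit, `α ∈ [0,π]`, `|α − θ| ≤ 1 − r` and
`0 < 1 − ϱ ≤ 2(1 − r)`. -/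
def symmBox (q : ℍ[ℝ]) : Set ℍ[ℝ] :=
  {p : ℍ[ℝ] | ‖p‖ < 1 ∧ ∃ (I : ℍ[ℝ]) (α ϱ : ℝ), I.re = 0 ∧ ‖I‖ = 1 ∧
    α ∈ Set.Icc 0 Real.pi ∧ |α - thetaOf q| ≤ 1 - ‖q‖ ∧
    0 < 1 - ϱ ∧ 1 - ϱ ≤ 2 * (1 - ‖q‖) ∧ p = ϱ • expQ I α}

theorem two_mul_mul_le_sq_add_sq (a b : ℝ≥0∞) : 2 * (a * b) ≤ a ^ 2 + b ^ 2 := by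
  rcases eq_or_ne a ⊤ with rfl | ha
  · simp
  rcases eq_or_ne b ⊤ with rfl | hb
  · simp
  lift a to NNReal using ha
  lift b to NNReal using hb
  norm_cast
  rw [← mul_assoc]
  exact two_mul_le_add_sq a b

theorem lintegral_kernel_form_le {X : Type*} [MeasurableSpace X] {ν : Measure X} [SFinite ν]
    {L S : X → X → ℝ≥0∞} (hL : Measurable (Function.uncurry L))
    (hS : Measurable (Function.uncurry S)) {C : ℝ≥0∞} (hC0 : C ≠ 0) (hC : C ≠ ⊤)
    (htest : ∀ x, ∫⁻ y, L x y ∂ν ≤ C) (hSL : ∀ x y, S x y ≤ L x y + L y x)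
    (hLL : ∀ x x' y, L x y * L x' y ≤ 4 * S x x' * (L x y + L x' y))
    {g : X → ℝ≥0∞} (hg : Measurable g) (hfin : ∫⁻ x, ∫⁻ y, L x y * (g x * g y) ∂ν ∂ν ≠ ⊤) :
    ∫⁻ x, ∫⁻ y, S x y * (g x * g y) ∂ν ∂ν ≤ 32 * C * ∫⁻ x, g x ^ 2 ∂ν := by
  have mL : ∀ {Y : Type _} [MeasurableSpace Y] {u v : Y → X}, Measurable u → Measurable v →
      Measurable fun y => L (u y) (v y) := fun hu hv => hL.comp (hu.prodMk hv)
  have mS : ∀ {Y : Type _} [MeasurableSpace Y] {u v : Y → X}, Measurable u → Measurable v →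
      Measurable fun y => S (u y) (v y) := fun hu hv => hS.comp (hu.prodMk hv)
  set Y := ∫⁻ x, ∫⁻ y, L x y * (g x * g y) ∂ν ∂ν with hY
  set h : X → ℝ≥0∞ := fun y => ∫⁻ x, L x y * g x ∂ν with hh
  have mh : Measurable h := by
    apply Measurable.lintegral_prod_right' (f := fun p : X × X => L p.2 p.1 * g p.2)
    exact (mL measurable_snd measurable_fst).mul (hg.comp measurable_snd)
  have hSY : ∫⁻ x, ∫⁻ y, S x y * (g x * g y) ∂ν ∂ν ≤ 2 * Y := by
    calc ∫⁻ x, ∫⁻ y, S x y * (g x * g y) ∂ν ∂ν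
        ≤ ∫⁻ x, ∫⁻ y, (L x y * (g x * g y) + L y x * (g y * g x)) ∂ν ∂ν := by
          refine lintegral_mono fun x => lintegral_mono fun y => ?_
          calc S x y * (g x * g y) ≤ (L x y + L y x) * (g x * g y) := by gcongr; exact hSL x y
            _ = _ := by ring
      _ = ∫⁻ x, ((∫⁻ y, L x y * (g x * g y) ∂ν) + ∫⁻ y, L y x * (g y * g x) ∂ν) ∂ν := by
          refine lintegral_congr fun x => lintegral_add_left ?_ _
          exact (mL measurable_const measurable_id).mul (measurable_const.mul hg)
      _ = Y + ∫⁻ x, ∫⁻ y, L y x * (g y * g x) ∂ν ∂ν := by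
          rw [lintegral_add_left]
          apply Measurable.lintegral_prod_right' (f := fun p : X × X => L p.1 p.2 * (g p.1 * g p.2))
          exact (mL measurable_fst measurable_snd).mul
            ((hg.comp measurable_fst).mul (hg.comp measurable_snd))
      _ = 2 * Y := by
          rw [lintegral_lintegral_swap, two_mul]
          exact ((mL measurable_snd measurable_fst).mul
            ((hg.comp measurable_snd).mul (hg.comp measurable_fst))).aemeasurable
  have hYgh : Y = ∫⁻ y, g y * h y ∂ν := by
    rw [hY, lintegral_lintegral_swap]
    · refine lintegral_congr fun y => ?_
      rw [hh, ← lintegral_const_mul]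
      · refine lintegral_congr fun x => by ring
      · exact (mL measurable_id measurable_const).mul hg
    · exact ((mL measurable_fst measurable_snd).mul
        ((hg.comp measurable_fst).mul (hg.comp measurable_snd))).aemeasurable
  have hXS : ∫⁻ y, h y ^ 2 ∂ν ≤ 8 * C * ∫⁻ x, ∫⁻ y, S x y * (g x * g y) ∂ν ∂ν := by
    calc ∫⁻ y, h y ^ 2 ∂ν
        = ∫⁻ y, ∫⁻ p : X × X, (L p.1 y * g p.1) * (L p.2 y * g p.2) ∂(ν.prod ν) ∂ν := by
          refine lintegral_congr fun y => ?_
          have m : Measurable fun x => L x y * g x := (mL measurable_id measurable_const).mul hg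
          rw [sq, hh]
          exact (lintegral_prod_mul m.aemeasurable m.aemeasurable).symm
      _ = ∫⁻ p : X × X, ∫⁻ y, (L p.1 y * g p.1) * (L p.2 y * g p.2) ∂ν ∂(ν.prod ν) := by
          rw [lintegral_lintegral_swap]
          refine Measurable.aemeasurable ?_
          have m1 : Measurable fun q : X × (X × X) => q.2.1 := by fun_prop
          have m2 : Measurable fun q : X × (X × X) => q.2.2 := by fun_prop
          exact ((mL m1 measurable_fst).mul (hg.comp m1)).mul
            ((mL m2 measurable_fst).mul (hg.comp m2))
      _ ≤ ∫⁻ p : X × X, 8 * C * (S p.1 p.2 * (g p.1 * g p.2)) ∂(ν.prod ν) := by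
          refine lintegral_mono fun p => ?_
          have m1 : Measurable fun y => L p.1 y := mL measurable_const measurable_id
          have m2 : Measurable fun y => L p.2 y := mL measurable_const measurable_id
          calc ∫⁻ y, (L p.1 y * g p.1) * (L p.2 y * g p.2) ∂ν
              ≤ ∫⁻ y, 4 * S p.1 p.2 * (g p.1 * g p.2) * (L p.1 y + L p.2 y) ∂ν := by
                refine lintegral_mono fun y => ?_
                calc (L p.1 y * g p.1) * (L p.2 y * g p.2)
                    = (L p.1 y * L p.2 y) * (g p.1 * g p.2) := by ring
                  _ ≤ (4 * S p.1 p.2 * (L p.1 y + L p.2 y)) * (g p.1 * g p.2) := by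
                    exact mul_le_mul_left (hLL _ _ _) _
                  _ = _ := by ring
            _ = 4 * S p.1 p.2 * (g p.1 * g p.2) *
                  ((∫⁻ y, L p.1 y ∂ν) + ∫⁻ y, L p.2 y ∂ν) := by
                rw [lintegral_const_mul _ (by fun_prop), lintegral_add_left m1]
            _ ≤ 4 * S p.1 p.2 * (g p.1 * g p.2) * (C + C) := by
                gcongr <;> exact htest _
            _ = _ := by ring
      _ = 8 * C * ∫⁻ x, ∫⁻ y, S x y * (g x * g y) ∂ν ∂ν := by
          have m : Measurable fun p : X × X => S p.1 p.2 * (g p.1 * g p.2) :=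
            (mS measurable_fst measurable_snd).mul
              ((hg.comp measurable_fst).mul (hg.comp measurable_snd))
          rw [lintegral_const_mul _ m, lintegral_prod _ m.aemeasurable]
  have hκ0 : 16 * C ≠ 0 := by simp [hC0]
  have hκ : 16 * C ≠ ⊤ := ENNReal.mul_ne_top (by simp) hC
  have hXY : ∫⁻ y, h y ^ 2 ∂ν ≤ 16 * C * Y := by
    calc _ ≤ 8 * C * (2 * Y) := hXS.trans (by gcongr)
      _ = _ := by ring
  have key : 16 * C * Y + 16 * C * Y ≤ 16 * C * (16 * C * ∫⁻ x, g x ^ 2 ∂ν) + 16 * C * Y := by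
    calc 16 * C * Y + 16 * C * Y = ∫⁻ y, 2 * ((16 * C * g y) * h y) ∂ν := by
          rw [← two_mul, hYgh, ← mul_assoc, ← lintegral_const_mul _ (by fun_prop)]
          refine lintegral_congr fun y => by ring
      _ ≤ ∫⁻ y, ((16 * C * g y) ^ 2 + h y ^ 2) ∂ν :=
          lintegral_mono fun y => two_mul_mul_le_sq_add_sq _ _
      _ = 16 * C * (16 * C * ∫⁻ x, g x ^ 2 ∂ν) + ∫⁻ y, h y ^ 2 ∂ν := by
          rw [lintegral_add_left (by fun_prop), ← mul_assoc,
            ← lintegral_const_mul _ (by fun_prop)]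
          congr 1
          refine lintegral_congr fun y => by ring
      _ ≤ _ := by gcongr
  have hY' : Y ≤ 16 * C * ∫⁻ x, g x ^ 2 ∂ν := by
    have := ENNReal.le_of_add_le_add_right (ENNReal.mul_ne_top hκ hfin) key
    exact (ENNReal.mul_le_mul_iff_right hκ0 hκ).1 this
  calc _ ≤ 2 * Y := hSY
    _ ≤ 2 * (16 * C * ∫⁻ x, g x ^ 2 ∂ν) := by gcongr
    _ = _ := by ring

/-- Comparable to `|1 - z * conj w|` for points `z`, `w` of the upper half of the unit disc, where
a point `ρ e^{iθ}` is recorded as the pair `(1 - ρ, θ)`. -/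
noncomputable def polarDist (p q : ℝ × ℝ) : ℝ := p.1 + q.1 + |p.2 - q.2|

/-- A kernel comparable to the Poisson kernel `(1 - |z w|²) / |1 - z * conj w|²`. -/
noncomputable def polarKernel (p q : ℝ × ℝ) : ℝ := max p.1 q.1 / polarDist p q ^ 2

/-- The part of `polarKernel p q` where `q` is at least as close to the circle as `p`. -/
noncomputable def lowerKernel (p q : ℝ × ℝ) : ℝ := if q.1 ≤ p.1 then polarKernel p q else 0

theorem polarDist_comm (p q : ℝ × ℝ) : polarDist p q = polarDist q p := by
  unfold polarDist; rw [abs_sub_comm]; ring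

theorem polarKernel_comm (p q : ℝ × ℝ) : polarKernel p q = polarKernel q p := by
  unfold polarKernel; rw [polarDist_comm, max_comm]

theorem polarDist_pos {p q : ℝ × ℝ} (hp : 0 < p.1) (hq : 0 < q.1) : 0 < polarDist p q := by
  unfold polarDist; positivity

theorem polarKernel_nonneg {p q : ℝ × ℝ} (hp : 0 < p.1) : 0 ≤ polarKernel p q :=
  div_nonneg (hp.le.trans (le_max_left _ _)) (sq_nonneg _)

theorem lowerKernel_nonneg {p q : ℝ × ℝ} (hp : 0 < p.1) : 0 ≤ lowerKernel p q := by
  unfold lowerKernel; split_ifs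
  exacts [polarKernel_nonneg hp, le_rfl]

theorem polarKernel_le {p q : ℝ × ℝ} (hp : 0 < p.1) (hq : 0 < q.1) :
    polarKernel p q ≤ lowerKernel p q + lowerKernel q p := by
  rcases le_total q.1 p.1 with h | h
  · have := lowerKernel_nonneg (q := p) hq
    rw [lowerKernel, if_pos h]; linarith
  · have := lowerKernel_nonneg (q := q) hp
    rw [lowerKernel.eq_def q p, if_pos h, polarKernel_comm q p]; linarith

theorem polarDist_triangle {p q r : ℝ × ℝ} (hr : 0 < r.1) :
    polarDist p q ≤ polarDist p r + polarDist q r := by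
  unfold polarDist
  have := abs_sub_le p.2 r.2 q.2
  rw [abs_sub_comm r.2 q.2] at this
  linarith

theorem lowerKernel_le_of_polarDist_le {p q r : ℝ × ℝ} (hp : 0 < p.1) (hq : 0 < q.1)
    (h : polarDist p q ≤ 2 * polarDist p r) : lowerKernel p r ≤ 4 * polarKernel p q := by
  have hD := polarDist_pos hp hq
  unfold lowerKernel
  split_ifs with hrp
  · unfold polarKernel
    rw [max_eq_left hrp, ← mul_div_assoc, div_le_div_iff₀ (by nlinarith) (by positivity)]
    have h2 : polarDist p q ^ 2 ≤ 4 * polarDist p r ^ 2 := by nlinarith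
    calc p.1 * polarDist p q ^ 2 ≤ p.1 * (4 * polarDist p r ^ 2) := by gcongr
      _ = 4 * p.1 * polarDist p r ^ 2 := by ring
      _ ≤ _ := by gcongr; exact le_max_left _ _
  · exact mul_nonneg (by norm_num) (polarKernel_nonneg hp)

theorem lowerKernel_mul_le {p q r : ℝ × ℝ} (hp : 0 < p.1) (hq : 0 < q.1) (hr : 0 < r.1) :
    lowerKernel p r * lowerKernel q r ≤
      4 * polarKernel p q * (lowerKernel p r + lowerKernel q r) := by
  have h1 := lowerKernel_nonneg (q := r) hp
  have h2 := lowerKernel_nonneg (q := r) hq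
  have h3 := polarKernel_nonneg (q := q) hp
  have h := polarDist_triangle (p := p) (q := q) hr
  rcases le_total (polarDist p q) (2 * polarDist p r) with h' | h'
  · have := lowerKernel_le_of_polarDist_le hp hq h'
    nlinarith [mul_le_mul_of_nonneg_right this h2, mul_nonneg h3 h1]
  · have : lowerKernel q r ≤ 4 * polarKernel q p :=
      lowerKernel_le_of_polarDist_le hq hp (by rw [polarDist_comm]; linarith)
    rw [polarKernel_comm] at this
    nlinarith [mul_le_mul_of_nonneg_left this h1, mul_nonneg h3 h2]

theorem measurable_polarKernel : Measurable (Function.uncurry polarKernel) := by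
  have h : Function.uncurry polarKernel = fun x : (ℝ × ℝ) × (ℝ × ℝ) =>
      max x.1.1 x.2.1 / (x.1.1 + x.2.1 + |x.1.2 - x.2.2|) ^ 2 := rfl
  rw [h]
  have : Measurable fun x : (ℝ × ℝ) × (ℝ × ℝ) => |x.1.2 - x.2.2| :=
    (continuous_abs.comp (by fun_prop : Continuous fun x : (ℝ × ℝ) × (ℝ × ℝ) =>
      x.1.2 - x.2.2)).measurable
  fun_prop

theorem measurable_lowerKernel : Measurable (Function.uncurry lowerKernel) := by
  refine Measurable.ite (p := fun x : (ℝ × ℝ) × (ℝ × ℝ) => x.2.1 ≤ x.1.1) ?_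
    measurable_polarKernel measurable_const
  exact measurableSet_le (by fun_prop) (by fun_prop)

theorem lowerKernel_le_tsum {p : ℝ × ℝ} (hp : 0 < p.1) {q : ℝ × ℝ} (hq : 0 < q.1) :
    ENNReal.ofReal (lowerKernel p q) ≤ ∑' k : ℕ,
      {r : ℝ × ℝ | r.1 ≤ 2 ^ k * p.1 ∧ |r.2 - p.2| ≤ 2 ^ k * p.1}.indicator
        (fun _ => ENNReal.ofReal (4 / (4 ^ k * p.1))) q := by
  classical
  rcases lt_or_ge p.1 q.1 with h | h
  · simp [lowerKernel, not_le.2 h]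
  have hex : ∃ k : ℕ, |q.2 - p.2| ≤ 2 ^ k * p.1 := by
    obtain ⟨k, hk⟩ := pow_unbounded_of_one_lt (|q.2 - p.2| / p.1) (one_lt_two : (1 : ℝ) < 2)
    exact ⟨k, (div_le_iff₀ hp).1 hk.le⟩
  refine le_trans ?_ (ENNReal.le_tsum (Nat.find hex))
  have hk := Nat.find_spec hex
  have hmin := fun m => Nat.find_min hex (m := m)
  generalize Nat.find hex = k at hk hmin
  have h1 : (1 : ℝ) ≤ 2 ^ k := one_le_pow₀ one_le_two
  have hmem : q ∈ {r : ℝ × ℝ | r.1 ≤ 2 ^ k * p.1 ∧ |r.2 - p.2| ≤ 2 ^ k * p.1} :=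
    ⟨by nlinarith, hk⟩
  rw [Set.indicator_of_mem hmem]
  apply ENNReal.ofReal_le_ofReal
  rw [lowerKernel, if_pos h, polarKernel, max_eq_left h,
    div_le_div_iff₀ (pow_pos (polarDist_pos hp hq) 2) (by positivity)]
  suffices h2 : 2 ^ k * p.1 ≤ 2 * polarDist p q by
    have h4 : (4 : ℝ) ^ k = (2 ^ k) ^ 2 := by rw [← pow_mul, mul_comm, pow_mul]; norm_num
    have := pow_le_pow_left₀ (by positivity) h2 2
    rw [h4]; nlinarith
  have h0 := abs_nonneg (p.2 - q.2)
  unfold polarDist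
  cases k with
  | zero => simp; linarith
  | succ m =>
    have := hmin m (Nat.lt_succ_self m)
    rw [not_le, abs_sub_comm] at this
    rw [pow_succ]; linarith

theorem lintegral_lowerKernel_le {X : Type*} [MeasurableSpace X] {ν : Measure X} {P : X → ℝ × ℝ}
    (hP : Measurable P) (hpos : ∀ x, 0 < (P x).1) {C : ℝ} (hC : 0 ≤ C)
    {p : ℝ × ℝ} (hp : 0 < p.1)
    (hbox : ∀ h : ℝ, 0 < h → ν {x | (P x).1 ≤ h ∧ |(P x).2 - p.2| ≤ h} ≤ ENNReal.ofReal (C * h)) :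
    ∫⁻ x, ENNReal.ofReal (lowerKernel p (P x)) ∂ν ≤ ENNReal.ofReal (8 * C) := by
  set E : ℕ → Set (ℝ × ℝ) := fun k => {r | r.1 ≤ 2 ^ k * p.1 ∧ |r.2 - p.2| ≤ 2 ^ k * p.1} with hE
  have mE : ∀ k, MeasurableSet (E k) := by
    intro k
    have h1 : IsClosed {r : ℝ × ℝ | r.1 ≤ 2 ^ k * p.1} := isClosed_le (by fun_prop) (by fun_prop)
    have h2 : IsClosed {r : ℝ × ℝ | |r.2 - p.2| ≤ 2 ^ k * p.1} :=
      isClosed_le (by fun_prop) (by fun_prop)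
    exact (h1.inter h2).measurableSet
  calc ∫⁻ x, ENNReal.ofReal (lowerKernel p (P x)) ∂ν
      ≤ ∫⁻ x, ∑' k : ℕ, (E k).indicator (fun _ => ENNReal.ofReal (4 / (4 ^ k * p.1))) (P x) ∂ν :=
        lintegral_mono fun x => lowerKernel_le_tsum hp (hpos x)
    _ = ∑' k : ℕ, ENNReal.ofReal (4 / (4 ^ k * p.1)) * ν (P ⁻¹' E k) := by
        rw [lintegral_tsum (f := fun k x =>
          (E k).indicator (fun _ => ENNReal.ofReal (4 / (4 ^ k * p.1))) (P x)) fun k =>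
          ((measurable_const.indicator (mE k)).comp hP).aemeasurable]
        refine tsum_congr fun k => ?_
        rw [← lintegral_indicator_const (hP (mE k))]
        rfl
    _ ≤ ∑' k : ℕ, ENNReal.ofReal (4 * C * (1 / 2) ^ k) := by
        refine ENNReal.tsum_le_tsum fun k => ?_
        have h2 : (0 : ℝ) < 2 ^ k := by positivity
        have h4 : (4 : ℝ) ^ k = 2 ^ k * 2 ^ k := by rw [← mul_pow]; norm_num
        calc _ ≤ ENNReal.ofReal (4 / (4 ^ k * p.1)) * ENNReal.ofReal (C * (2 ^ k * p.1)) := by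
              gcongr; exact hbox _ (by positivity)
          _ = _ := by
              rw [← ENNReal.ofReal_mul (by positivity), h4, one_div, inv_pow]
              congr 1
              field_simp
    _ = ENNReal.ofReal (8 * C) := by
        have hs := summable_geometric_two.mul_left (4 * C)
        rw [← ENNReal.ofReal_tsum_of_nonneg (fun k => by positivity) hs, tsum_mul_left,
          tsum_geometric_two]
        congr 1; ring

theorem abs_re_inv_one_sub_le {ρ₁ θ₁ ρ₂ θ₂ : ℝ} (h₁ : 0 ≤ ρ₁) (h₁' : ρ₁ < 1) (h₂ : 0 ≤ ρ₂)
    (h₂' : ρ₂ < 1) (hθ : |θ₁ - θ₂| ≤ Real.pi) :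
    |((1 - (ρ₁ * Complex.exp (θ₁ * Complex.I)) *
      (starRingEnd ℂ) (ρ₂ * Complex.exp (θ₂ * Complex.I)))⁻¹).re| ≤
      1 / 2 + 56 * polarKernel (1 - ρ₁, θ₁) (1 - ρ₂, θ₂) := by
  set φ := θ₁ - θ₂ with hφ
  set ρ := ρ₁ * ρ₂ with hρ
  have hu : (ρ₁ * Complex.exp (θ₁ * Complex.I)) *
      (starRingEnd ℂ) (ρ₂ * Complex.exp (θ₂ * Complex.I)) = ρ * Complex.exp (φ * Complex.I) := by
    rw [map_mul, ← Complex.exp_conj, map_mul, Complex.conj_I, Complex.conj_ofReal,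
      Complex.conj_ofReal, mul_mul_mul_comm, ← Complex.exp_add, hφ, hρ]
    push_cast
    ring_nf
  have hre : (1 - ρ * Complex.exp (φ * Complex.I) : ℂ).re = 1 - ρ * Real.cos φ := by
    simp [Complex.exp_ofReal_mul_I_re]
  have him : (1 - ρ * Complex.exp (φ * Complex.I) : ℂ).im = - (ρ * Real.sin φ) := by
    simp [Complex.exp_ofReal_mul_I_im]
  rw [hu, Complex.inv_re, Complex.normSq_apply, hre, him]
  have hcs := Real.sin_sq_add_cos_sq φ
  have hN : (1 - ρ * Real.cos φ) * (1 - ρ * Real.cos φ) + -(ρ * Real.sin φ) * -(ρ * Real.sin φ)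
      = (1 - ρ) ^ 2 + 2 * ρ * (1 - Real.cos φ) := by linear_combination ρ ^ 2 * hcs
  rw [hN]
  have hρ0 : 0 ≤ ρ := mul_nonneg h₁ h₂
  have hρ1 : ρ < 1 := mul_lt_one_of_nonneg_of_lt_one_left h₁ h₁' h₂'.le
  have hcos := Real.cos_le_one_sub_mul_cos_sq hθ
  set s := φ ^ 2 / Real.pi ^ 2 with hs
  have hs0 : 0 ≤ s := by positivity
  have hs1 : s ≤ 1 := by
    rw [hs, div_le_one (by positivity)]
    exact sq_le_sq' (by linarith [(abs_le.1 hθ).1]) (abs_le.1 hθ).2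
  have hcos' : 2 * s ≤ 1 - Real.cos φ := by
    have : 2 / Real.pi ^ 2 * φ ^ 2 = 2 * s := by rw [hs]; ring
    linarith
  have hφs : φ ^ 2 ≤ 10 * s := by
    have : φ ^ 2 = Real.pi ^ 2 * s := by rw [hs]; field_simp
    have hpi : Real.pi ^ 2 ≤ 10 := by nlinarith [Real.pi_pos, Real.pi_lt_d2]
    rw [this]; gcongr
  set N := (1 - ρ) ^ 2 + 2 * ρ * (1 - Real.cos φ) with hNdef
  have hρcos := mul_le_mul_of_nonneg_left hcos' hρ0
  have hρs := mul_nonneg hρ0 hs0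
  have hNρ : (1 - ρ) ^ 2 ≤ N := by linarith
  have hNs : s ≤ N := by
    have := mul_le_mul_of_nonneg_right hs1 (sq_nonneg (1 - ρ))
    have := mul_nonneg hs0 (sq_nonneg ρ)
    linarith
  have hNpos : 0 < N := lt_of_lt_of_le (pow_pos (sub_pos.2 hρ1) 2) hNρ
  have hd : (1 - ρ₁) + (1 - ρ₂) ≤ 2 * (1 - ρ) := by
    have := mul_nonneg (sub_nonneg.2 h₁'.le) h₂
    have := mul_nonneg (sub_nonneg.2 h₂'.le) h₁
    rw [hρ]; linarith
  have hD : polarDist (1 - ρ₁, θ₁) (1 - ρ₂, θ₂) ^ 2 ≤ 28 * N := by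
    unfold polarDist
    simp only [← hφ]
    have h1 : ((1 - ρ₁) + (1 - ρ₂)) ^ 2 ≤ (2 * (1 - ρ)) ^ 2 :=
      pow_le_pow_left₀ (by linarith) hd 2
    have h2 := add_sq_le (a := (1 - ρ₁) + (1 - ρ₂)) (b := |φ|)
    rw [sq_abs] at h2
    linarith
  have hDpos : 0 < polarDist (1 - ρ₁, θ₁) (1 - ρ₂, θ₂) :=
    polarDist_pos (by simpa using h₁') (by simpa using h₂')
  have hmax : 1 - ρ ≤ 2 * max (1 - ρ₁) (1 - ρ₂) := by
    have := le_max_left (1 - ρ₁) (1 - ρ₂)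
    have := le_max_right (1 - ρ₁) (1 - ρ₂)
    have := mul_nonneg (sub_nonneg.2 h₁'.le) (sub_nonneg.2 h₂'.le)
    rw [hρ]; linarith
  have hident : (1 - ρ * Real.cos φ) / N = 1 / 2 + (1 - ρ ^ 2) / (2 * N) := by
    field_simp
    rw [hNdef]; ring
  have hcos1 : 0 ≤ 1 - ρ * Real.cos φ := by
    have := mul_le_mul_of_nonneg_left (Real.cos_le_one φ) hρ0
    linarith
  rw [abs_of_nonneg (div_nonneg hcos1 hNpos.le), hident]
  have h1 : (1 - ρ ^ 2) / (2 * N) ≤ (1 - ρ) / N := by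
    rw [div_le_div_iff₀ (by positivity) hNpos]
    have : 0 ≤ N * (1 - ρ) ^ 2 := by positivity
    linarith
  have h2 : (1 - ρ) / N ≤ 56 * polarKernel (1 - ρ₁, θ₁) (1 - ρ₂, θ₂) := by
    unfold polarKernel
    rw [← mul_div_assoc, div_le_div_iff₀ hNpos (by positivity)]
    simp only
    calc (1 - ρ) * polarDist (1 - ρ₁, θ₁) (1 - ρ₂, θ₂) ^ 2
        ≤ (2 * max (1 - ρ₁) (1 - ρ₂)) * (28 * N) := by gcongr
      _ = _ := by ring
  linarith

theorem polarKernel_le_inv {p q : ℝ × ℝ} {δ : ℝ} (hδ : 0 < δ) (hp : δ ≤ p.1) (hq : δ ≤ q.1) :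
    polarKernel p q ≤ δ⁻¹ := by
  have hD : max p.1 q.1 + δ ≤ polarDist p q := by
    unfold polarDist
    have := abs_nonneg (p.2 - q.2)
    rcases max_cases p.1 q.1 with h | h <;> linarith
  have hm : 0 < max p.1 q.1 := lt_of_lt_of_le hδ (hp.trans (le_max_left _ _))
  unfold polarKernel
  rw [inv_eq_one_div, div_le_div_iff₀ (by nlinarith) hδ]
  nlinarith

theorem lintegral_polarKernel_le {X : Type*} [MeasurableSpace X] {ν : Measure X}
    [IsFiniteMeasure ν] {P : X → ℝ × ℝ} (hP : Measurable P) {δ : ℝ} (hδ : 0 < δ)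
    (hPδ : ∀ x, δ ≤ (P x).1) {C : ℝ} (hC : 0 < C)
    (hbox : ∀ x, ∀ h : ℝ, 0 < h →
      ν {y | (P y).1 ≤ h ∧ |(P y).2 - (P x).2| ≤ h} ≤ ENNReal.ofReal (C * h))
    {g : X → ℝ} (hg : Measurable g) {G : ℝ} (hG : ∀ x, |g x| ≤ G) :
    ∫⁻ x, ∫⁻ y, ENNReal.ofReal (polarKernel (P x) (P y)) *
        (ENNReal.ofReal |g x| * ENNReal.ofReal |g y|) ∂ν ∂ν ≤
      ENNReal.ofReal (256 * C) * ∫⁻ x, ENNReal.ofReal (g x ^ 2) ∂ν := by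
  have hpos : ∀ x, 0 < (P x).1 := fun x => hδ.trans_le (hPδ x)
  have mPP : Measurable fun x : X × X => (P x.1, P x.2) :=
    (hP.comp measurable_fst).prodMk (hP.comp measurable_snd)
  have mabs : Measurable fun x => |g x| := continuous_abs.measurable.comp hg
  have h32 : ENNReal.ofReal (256 * C) = 32 * ENNReal.ofReal (8 * C) := by
    rw [show 256 * C = 32 * (8 * C) by ring, ENNReal.ofReal_mul (by norm_num)]
    norm_num
  have hsq : ∀ x, ENNReal.ofReal (g x ^ 2) = ENNReal.ofReal |g x| ^ 2 := fun x => by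
    rw [← ENNReal.ofReal_pow (abs_nonneg _), sq_abs]
  simp_rw [h32, hsq]
  refine lintegral_kernel_form_le
    (L := fun x y => ENNReal.ofReal (lowerKernel (P x) (P y)))
    (S := fun x y => ENNReal.ofReal (polarKernel (P x) (P y)))
    (measurable_lowerKernel.comp mPP).ennreal_ofReal
    (measurable_polarKernel.comp mPP).ennreal_ofReal ?_ ENNReal.ofReal_ne_top ?_ ?_ ?_
    mabs.ennreal_ofReal ?_
  · simpa using hC
  · exact fun x => lintegral_lowerKernel_le hP hpos hC.le (hpos x) (hbox x)
  · intro x y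
    rw [← ENNReal.ofReal_add (lowerKernel_nonneg (hpos x)) (lowerKernel_nonneg (hpos y))]
    exact ENNReal.ofReal_le_ofReal (polarKernel_le (hpos x) (hpos y))
  · intro x x' y
    have h1 := lowerKernel_nonneg (q := P y) (hpos x)
    have h2 := lowerKernel_nonneg (q := P y) (hpos x')
    have h3 := polarKernel_nonneg (q := P x') (hpos x)
    rw [← ENNReal.ofReal_add h1 h2, ← ENNReal.ofReal_mul h1,
      show (4 : ℝ≥0∞) = ENNReal.ofReal 4 by norm_num, ← ENNReal.ofReal_mul (by norm_num),
      ← ENNReal.ofReal_mul (by positivity)]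
    exact ENNReal.ofReal_le_ofReal (lowerKernel_mul_le (hpos x) (hpos x') (hpos y))
  · have hle : ∀ x y, ENNReal.ofReal (lowerKernel (P x) (P y)) *
        (ENNReal.ofReal |g x| * ENNReal.ofReal |g y|) ≤
        ENNReal.ofReal δ⁻¹ * (ENNReal.ofReal G * ENNReal.ofReal G) := by
      intro x y
      gcongr
      · unfold lowerKernel
        split_ifs
        · exact polarKernel_le_inv hδ (hPδ x) (hPδ y)
        · positivity
      · exact hG x
      · exact hG y
    refine ne_top_of_le_ne_top ?_ (lintegral_mono fun x => lintegral_mono fun y => hle x y)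
    simp only [lintegral_const]
    finiteness

theorem enorm_integral_prod_le {X : Type*} [MeasurableSpace X] {ν : Measure X}
    [IsFiniteMeasure ν] {P : X → ℝ × ℝ} (hP : Measurable P) {δ : ℝ} (hδ : 0 < δ)
    (hPδ : ∀ x, δ ≤ (P x).1) {C : ℝ} (hC : 0 < C)
    (hbox : ∀ x, ∀ h : ℝ, 0 < h →
      ν {y | (P y).1 ≤ h ∧ |(P y).2 - (P x).2| ≤ h} ≤ ENNReal.ofReal (C * h))
    (huniv : ν Set.univ ≤ ENNReal.ofReal (4 * C))
    {g : X → ℝ} (hg : Measurable g) {G : ℝ} (hG : ∀ x, |g x| ≤ G) {κ : X × X → ℝ}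
    (hκ : ∀ p, |κ p| ≤ 1 / 2 + 56 * polarKernel (P p.1) (P p.2)) :
    ‖∫ p, g p.1 * g p.2 * κ p ∂(ν.prod ν)‖ₑ ≤
      ENNReal.ofReal (15000 * C) * ∫⁻ x, ENNReal.ofReal (g x ^ 2) ∂ν := by
  have mPP : Measurable fun x : X × X => (P x.1, P x.2) :=
    (hP.comp measurable_fst).prodMk (hP.comp measurable_snd)
  have mK : Measurable fun p : X × X => ENNReal.ofReal (polarKernel (P p.1) (P p.2)) :=
    (measurable_polarKernel.comp mPP).ennreal_ofReal
  have mabs : Measurable fun x => |g x| := continuous_abs.measurable.comp hg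
  set T := ∫⁻ x, ENNReal.ofReal (g x ^ 2) ∂ν with hT
  calc ‖∫ p, g p.1 * g p.2 * κ p ∂(ν.prod ν)‖ₑ
      ≤ ∫⁻ p, ‖g p.1 * g p.2 * κ p‖ₑ ∂(ν.prod ν) := enorm_integral_le_lintegral_enorm _
    _ ≤ ∫⁻ p, (ENNReal.ofReal (g p.1 ^ 2) + ENNReal.ofReal (g p.2 ^ 2) +
          56 * (ENNReal.ofReal (polarKernel (P p.1) (P p.2)) *
            (ENNReal.ofReal |g p.1| * ENNReal.ofReal |g p.2|))) ∂(ν.prod ν) := by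
        refine lintegral_mono fun p => ?_
        have h3 := polarKernel_nonneg (q := P p.2) (hδ.trans_le (hPδ p.1))
        have ha := abs_nonneg (g p.1)
        have hb := abs_nonneg (g p.2)
        rw [Real.enorm_eq_ofReal_abs, ← ENNReal.ofReal_mul ha, ← ENNReal.ofReal_mul h3,
          show (56 : ℝ≥0∞) = ENNReal.ofReal 56 by norm_num, ← ENNReal.ofReal_mul (by norm_num),
          ← ENNReal.ofReal_add (by positivity) (by positivity),
          ← ENNReal.ofReal_add (by positivity) (by positivity)]
        apply ENNReal.ofReal_le_ofReal
        rw [abs_mul, abs_mul, ← sq_abs (g p.1), ← sq_abs (g p.2)]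
        have := mul_le_mul_of_nonneg_left (hκ p) (mul_nonneg ha hb)
        nlinarith [sq_nonneg (|g p.1| - |g p.2|)]
    _ = (∫⁻ x, ∫⁻ y, ENNReal.ofReal (g x ^ 2) ∂ν ∂ν) +
          (∫⁻ x, ∫⁻ y, ENNReal.ofReal (g y ^ 2) ∂ν ∂ν) +
          56 * ∫⁻ x, ∫⁻ y, ENNReal.ofReal (polarKernel (P x) (P y)) *
            (ENNReal.ofReal |g x| * ENNReal.ofReal |g y|) ∂ν ∂ν := by
        rw [lintegral_add_left (by fun_prop), lintegral_add_left (by fun_prop),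
          lintegral_const_mul _ (by fun_prop), lintegral_prod _ (by fun_prop),
          lintegral_prod _ (by fun_prop), lintegral_prod _ (by fun_prop)]
    _ ≤ T * ENNReal.ofReal (4 * C) + T * ENNReal.ofReal (4 * C) +
          56 * (ENNReal.ofReal (256 * C) * T) := by
        simp only [lintegral_const]
        rw [lintegral_mul_const _ (by fun_prop)]
        gcongr
        exact lintegral_polarKernel_le hP hδ hPδ hC hbox hg hG
    _ = ENNReal.ofReal (14344 * C) * T := by
        rw [show 14344 * C = 4 * C + 4 * C + 56 * (256 * C) by ring,
          ENNReal.ofReal_add (by positivity) (by positivity),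
          ENNReal.ofReal_add (by positivity) (by positivity),
          ENNReal.ofReal_mul (p := 56) (by norm_num), show ENNReal.ofReal 56 = 56 by norm_num]
        ring
    _ ≤ _ := by gcongr; norm_num

theorem integrable_of_measurable_of_norm_le {Y E : Type*} [MeasurableSpace Y]
    [NormedAddCommGroup E] [MeasurableSpace E] [BorelSpace E] [SecondCountableTopology E]
    {ν : Measure Y} [IsFiniteMeasure ν] {f : Y → E} (hf : Measurable f) {B : ℝ}
    (hB : ∀ y, ‖f y‖ ≤ B) : Integrable f ν :=
  Integrable.of_bound hf.aestronglyMeasurable B (Filter.Eventually.of_forall hB)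

/-- Both power-series identities behind the `L²` estimate: `∫ g²` and the squares of the moments
`bₙ = ∫ zⁿ g` of `g = Re ∑ cₙ zⁿ`. -/
theorem integral_sq_le_of_moments {X : Type*} [MeasurableSpace X] {ν : Measure X}
    [IsFiniteMeasure ν] {z : X → ℂ} (hz : Measurable z) {R : ℝ} (hR0 : 0 ≤ R) (hR : R < 1)
    (hzR : ∀ x, ‖z x‖ ≤ R) {c : ℕ → ℂ} (hc : Summable fun n => ‖c n‖ ^ 2)
    {K : ℝ} (hK : 0 < K)
    (hker : ∀ (g : X → ℝ) (G : ℝ), Measurable g → (∀ x, |g x| ≤ G) →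
      ∫ p : X × X, g p.1 * g p.2 * ((1 - z p.1 * (starRingEnd ℂ) (z p.2))⁻¹).re ∂(ν.prod ν) ≤
        K * ∫ x, g x ^ 2 ∂ν) :
    Integrable (fun x => (∑' n, c n * z x ^ n).re ^ 2) ν ∧
    ∫ x, (∑' n, c n * z x ^ n).re ^ 2 ∂ν ≤ K * ∑' n, ‖c n‖ ^ 2 := by
  obtain ⟨M, hM0, hM⟩ : ∃ M : ℝ, 0 ≤ M ∧ ∀ n, ‖c n‖ ≤ M := by
    refine ⟨1 + ∑' n, ‖c n‖ ^ 2, by positivity, fun n => ?_⟩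
    have := hc.le_tsum n (fun _ _ => by positivity)
    nlinarith [sq_nonneg (‖c n‖ - 1)]
  have hzn : ∀ x n, ‖z x ^ n‖ ≤ R ^ n := fun x n => by
    rw [norm_pow]; exact pow_le_pow_left₀ (norm_nonneg _) (hzR x) n
  have hterm : ∀ x n, ‖c n * z x ^ n‖ ≤ M * R ^ n := fun x n => by
    rw [norm_mul]; exact mul_le_mul (hM n) (hzn x n) (norm_nonneg _) hM0
  have hgeom : Summable fun n => M * R ^ n := (summable_geometric_of_lt_one hR0 hR).mul_left M
  have hsum : ∀ x, Summable fun n => c n * z x ^ n := fun x =>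
    Summable.of_norm_bounded hgeom (hterm x)
  set g : X → ℝ := fun x => (∑' n, c n * z x ^ n).re with hg
  have mg : Measurable g := by
    refine Complex.measurable_re.comp (measurable_of_tendsto_metrizable
      (f := fun N x => ∑ n ∈ Finset.range N, c n * z x ^ n) (fun N => by fun_prop) ?_)
    rw [tendsto_pi_nhds]
    exact fun x => (hsum x).hasSum.tendsto_sum_nat
  set G : ℝ := ∑' n, M * R ^ n with hGdef
  have hG : ∀ x, |g x| ≤ G := fun x =>
    (Complex.abs_re_le_norm _).trans (tsum_of_norm_bounded hgeom.hasSum (hterm x))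
  have hG' : 0 ≤ G := tsum_nonneg fun n => by positivity
  have hint : Integrable (fun x => g x ^ 2) ν := by
    refine integrable_of_measurable_of_norm_le (by fun_prop) (B := G ^ 2) fun x => ?_
    rw [norm_pow, Real.norm_eq_abs]
    exact pow_le_pow_left₀ (abs_nonneg _) (hG x) 2
  refine ⟨hint, ?_⟩
  set b : ℕ → ℂ := fun n => ∫ x, z x ^ n * (g x : ℂ) ∂ν with hb
  have hfn : ∀ n x, ‖z x ^ n * (g x : ℂ)‖ ≤ R ^ n * G := fun n x => by
    rw [norm_mul, Complex.norm_real]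
    exact mul_le_mul (hzn x n) (hG x) (norm_nonneg _) (by positivity)
  have mfn : ∀ n, Measurable fun x => z x ^ n * (g x : ℂ) := fun n => by fun_prop
  -- expansion of `∫ g ^ 2`
  have h1 : HasSum (fun n => (c n * b n).re) (∫ x, g x ^ 2 ∂ν) := by
    have hF : ∀ n x, ‖(c n * (z x ^ n * (g x : ℂ))).re‖ ≤ M * G * R ^ n := fun n x => by
      refine (Complex.abs_re_le_norm _).trans ?_
      rw [norm_mul]
      calc _ ≤ M * (R ^ n * G) := mul_le_mul (hM n) (hfn n x) (norm_nonneg _) hM0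
        _ = _ := by ring
    have hFi : ∀ n, Integrable (fun x => (c n * (z x ^ n * (g x : ℂ))).re) ν := fun n =>
      integrable_of_measurable_of_norm_le
        (Complex.measurable_re.comp ((mfn n).const_mul _)) (hF n)
    have hs := hasSum_integral_of_summable_integral_norm hFi (by
      refine Summable.of_nonneg_of_le (fun n => integral_nonneg fun x => norm_nonneg _)
        (fun n => ?_) ((summable_geometric_of_lt_one hR0 hR).mul_left (M * G * ν.real Set.univ))
      calc _ ≤ ∫ _, M * G * R ^ n ∂ν :=
            integral_mono (hFi n).norm (integrable_const _) (hF n)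
        _ = _ := by simp; ring)
    have e1 : ∀ n, (c n * b n).re = ∫ x, (c n * (z x ^ n * (g x : ℂ))).re ∂ν := fun n => by
      have hi : Integrable (fun x => c n * (z x ^ n * (g x : ℂ))) ν :=
        (integrable_of_measurable_of_norm_le (mfn n) (hfn n)).const_mul _
      rw [hb]
      simp only
      rw [← integral_const_mul]
      exact (integral_re hi).symm
    have e2 : ∀ x, g x ^ 2 = ∑' n, (c n * (z x ^ n * (g x : ℂ))).re := fun x => by
      have h := (Complex.hasSum_re (hsum x).hasSum).mul_right (g x)
      have e3 : ∀ n, (c n * z x ^ n).re * g x = (c n * (z x ^ n * (g x : ℂ))).re := fun n => by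
        rw [← mul_assoc, Complex.re_mul_ofReal]
      rw [funext e3] at h
      rw [h.tsum_eq, sq]
    rw [funext e1, funext e2]
    exact hs
  -- expansion of the kernel
  have h2 : HasSum (fun n => ‖b n‖ ^ 2)
      (∫ p : X × X, g p.1 * g p.2 * ((1 - z p.1 * (starRingEnd ℂ) (z p.2))⁻¹).re
        ∂(ν.prod ν)) := by
    set F : ℕ → X × X → ℂ := fun n p =>
      (z p.1 ^ n * (g p.1 : ℂ)) * (starRingEnd ℂ) (z p.2 ^ n * (g p.2 : ℂ)) with hFdef
    have mF : ∀ n, Measurable (F n) := fun n =>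
      ((mfn n).comp measurable_fst).mul
        (Complex.continuous_conj.measurable.comp ((mfn n).comp measurable_snd))
    have hF : ∀ n p, ‖F n p‖ ≤ G ^ 2 * R ^ n := fun n p => by
      rw [hFdef]
      simp only
      rw [norm_mul, RCLike.norm_conj]
      have hRn : R ^ n ≤ 1 := pow_le_one₀ hR0 hR.le
      calc _ ≤ (R ^ n * G) * (R ^ n * G) :=
            mul_le_mul (hfn n _) (hfn n _) (norm_nonneg _) (by positivity)
        _ = R ^ n * (G ^ 2 * R ^ n) := by ring
        _ ≤ _ := mul_le_of_le_one_left (by positivity) hRn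
    have hFi : ∀ n, Integrable (F n) (ν.prod ν) := fun n =>
      integrable_of_measurable_of_norm_le (mF n) (hF n)
    have hs := hasSum_integral_of_summable_integral_norm (fun n => (hFi n).re) (by
      refine Summable.of_nonneg_of_le (fun n => integral_nonneg fun x => norm_nonneg _)
        (fun n => ?_) ((summable_geometric_of_lt_one hR0 hR).mul_left
          (G ^ 2 * (ν.prod ν).real Set.univ))
      calc _ ≤ ∫ _, G ^ 2 * R ^ n ∂(ν.prod ν) :=
            integral_mono (hFi n).re.norm (integrable_const _)
              fun p => (Complex.abs_re_le_norm _).trans (hF n p)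
        _ = _ := by simp; ring)
    have e1 : ∀ n, ‖b n‖ ^ 2 = ∫ p, RCLike.re (F n p) ∂(ν.prod ν) := fun n => by
      rw [integral_re (hFi n), hFdef]
      simp only
      rw [integral_prod_mul (fun x => z x ^ n * (g x : ℂ))
        (fun x => (starRingEnd ℂ) (z x ^ n * (g x : ℂ))), integral_conj]
      change _ = (b n * (starRingEnd ℂ) (b n)).re
      rw [Complex.mul_conj, Complex.ofReal_re, Complex.normSq_eq_norm_sq]
    have e2 : ∀ p : X × X, g p.1 * g p.2 * ((1 - z p.1 * (starRingEnd ℂ) (z p.2))⁻¹).re =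
        ∑' n, RCLike.re (F n p) := fun p => by
      have hlt : ‖z p.1 * (starRingEnd ℂ) (z p.2)‖ < 1 := by
        rw [norm_mul, RCLike.norm_conj]
        nlinarith [hzR p.1, hzR p.2, norm_nonneg (z p.1), norm_nonneg (z p.2)]
      have h := (Complex.hasSum_re (hasSum_geometric_of_norm_lt_one hlt)).mul_left (g p.1 * g p.2)
      have e3 : ∀ n, g p.1 * g p.2 * ((z p.1 * (starRingEnd ℂ) (z p.2)) ^ n).re =
          RCLike.re (F n p) := fun n => by
        have : F n p = ((g p.1 * g p.2 : ℝ) : ℂ) * (z p.1 * (starRingEnd ℂ) (z p.2)) ^ n := by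
          rw [hFdef]
          simp only [map_mul, map_pow, Complex.conj_ofReal]
          push_cast; ring
        rw [this]
        exact (Complex.re_ofReal_mul _ _).symm
      rw [funext e3] at h
      exact h.tsum_eq.symm
    rw [funext e1, funext e2]
    exact hs
  have h3 := hker g G mg hG
  have h4 : ∫ x, g x ^ 2 ∂ν ≤ (K / 2) * (∑' n, ‖c n‖ ^ 2) + (1 / (2 * K)) *
      ∫ p : X × X, g p.1 * g p.2 * ((1 - z p.1 * (starRingEnd ℂ) (z p.2))⁻¹).re
        ∂(ν.prod ν) := by
    refine hasSum_le (fun n => ?_) h1 ((hc.hasSum.mul_left (K / 2)).add (h2.mul_left (1 / (2 * K))))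
    calc (c n * b n).re ≤ ‖c n‖ * ‖b n‖ := by
          rw [← norm_mul]; exact (le_abs_self _).trans (Complex.abs_re_le_norm _)
      _ ≤ _ := by
          have : K / 2 * ‖c n‖ ^ 2 + 1 / (2 * K) * ‖b n‖ ^ 2 - ‖c n‖ * ‖b n‖ =
            (K * ‖c n‖ - ‖b n‖) ^ 2 / (2 * K) := by field_simp; ring
          have : 0 ≤ (K * ‖c n‖ - ‖b n‖) ^ 2 / (2 * K) := by positivity
          linarith
  have h5 := mul_le_mul_of_nonneg_left h3 (by positivity : 0 ≤ 1 / (2 * K))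
  have h6 : 1 / (2 * K) * (K * ∫ x, g x ^ 2 ∂ν) = (∫ x, g x ^ 2 ∂ν) / 2 := by field_simp
  linarith

theorem lintegral_re_tsum_sq_le {X : Type*} [MeasurableSpace X] {ν : Measure X} {ρ θ : X → ℝ}
    (mρ : Measurable ρ) (mθ : Measurable θ) {R : ℝ} (hR : R < 1) (hρ0 : ∀ x, 0 ≤ ρ x)
    (hρR : ∀ x, ρ x ≤ R) (hθ : ∀ x, θ x ∈ Set.Icc 0 Real.pi) {C : ℝ} (hC : 0 < C)
    (hbox : ∀ t ∈ Set.Icc 0 Real.pi, ∀ h : ℝ, 0 < h →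
      ν {x | 1 - ρ x ≤ h ∧ |θ x - t| ≤ h} ≤ ENNReal.ofReal (C * h))
    {c : ℕ → ℂ} (hc : Summable fun n => ‖c n‖ ^ 2) :
    ∫⁻ x, ENNReal.ofReal ((∑' n, c n * (ρ x * Complex.exp (θ x * Complex.I)) ^ n).re ^ 2) ∂ν ≤
      ENNReal.ofReal (15000 * C * ∑' n, ‖c n‖ ^ 2) := by
  have huniv : ν Set.univ ≤ ENNReal.ofReal (4 * C) := by
    rw [mul_comm]
    refine le_trans (measure_mono fun x _ => Set.mem_ofPred.2 ⟨?_, ?_⟩)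
      (hbox 0 ⟨le_rfl, Real.pi_pos.le⟩ 4 (by norm_num))
    · linarith [hρ0 x]
    · rw [sub_zero, abs_of_nonneg (hθ x).1]
      linarith [(hθ x).2, Real.pi_le_four]
  have : IsFiniteMeasure ν := ⟨huniv.trans_lt ENNReal.ofReal_lt_top⟩
  rcases isEmpty_or_nonempty X with hX | ⟨⟨x₀⟩⟩
  · simp [lintegral_of_isEmpty]
  have hR0 : 0 ≤ R := (hρ0 x₀).trans (hρR x₀)
  set z : X → ℂ := fun x => ρ x * Complex.exp (θ x * Complex.I) with hz
  have mz : Measurable z := by fun_prop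
  have hzR : ∀ x, ‖z x‖ ≤ R := fun x => by
    rw [hz]
    simp only
    rw [norm_mul, Complex.norm_exp_ofReal_mul_I, mul_one, Complex.norm_real, Real.norm_eq_abs,
      abs_of_nonneg (hρ0 x)]
    exact hρR x
  have key := integral_sq_le_of_moments (ν := ν) mz hR0 hR hzR hc (K := 15000 * C) (by positivity) (by
    intro g G mg hG
    have hint : Integrable (fun x => g x ^ 2) ν := by
      refine integrable_of_measurable_of_norm_le (by fun_prop) (B := G ^ 2) fun x => ?_
      rw [norm_pow, Real.norm_eq_abs]
      exact pow_le_pow_left₀ (abs_nonneg _) (hG x) 2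
    have h := enorm_integral_prod_le (ν := ν) (P := fun x => (1 - ρ x, θ x)) (by fun_prop)
      (δ := 1 - R) (by linarith) (fun x => sub_le_sub_left (hρR x) 1) hC
      (fun x => hbox (θ x) (hθ x)) huniv mg hG
      (κ := fun p => ((1 - z p.1 * (starRingEnd ℂ) (z p.2))⁻¹).re) (fun p => by
        refine abs_re_inv_one_sub_le (hρ0 _) ((hρR _).trans_lt hR) (hρ0 _)
          ((hρR _).trans_lt hR) (abs_le.2 ⟨?_, ?_⟩) <;>
        linarith [(hθ p.1).1, (hθ p.1).2, (hθ p.2).1, (hθ p.2).2])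
    rw [← ofReal_integral_eq_lintegral_ofReal hint (Filter.Eventually.of_forall fun x =>
      sq_nonneg _), ← ENNReal.ofReal_mul (by positivity), Real.enorm_eq_ofReal_abs] at h
    have hnn : 0 ≤ 15000 * C * ∫ x, g x ^ 2 ∂ν :=
      mul_nonneg (by positivity) (integral_nonneg fun x => sq_nonneg _)
    exact (le_abs_self _).trans ((ENNReal.ofReal_le_ofReal_iff hnn).1 h))
  rw [← ofReal_integral_eq_lintegral_ofReal key.1 (Filter.Eventually.of_forall fun x =>
      sq_nonneg _)]
  exact ENNReal.ofReal_le_ofReal key.2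

theorem mul_self_eq_neg_one_of_norm_eq_one {I : ℍ[ℝ]} (h0 : I.re = 0) (h1 : ‖I‖ = 1) :
    I * I = -1 := by
  have h := Quaternion.normSq_eq_norm_mul_self I
  rw [h1, Quaternion.normSq_def', h0] at h
  ext <;> simp [h0]
  · nlinarith
  all_goals ring_nf

theorem norm_liftAux_quaternion {I : ℍ[ℝ]} (h0 : I.re = 0) (h1 : ‖I‖ = 1) (z : ℂ) :
    ‖Complex.liftAux I (mul_self_eq_neg_one_of_norm_eq_one h0 h1) z‖ = ‖z‖ := by
  have h := Quaternion.normSq_eq_norm_mul_self I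
  rw [h1, Quaternion.normSq_def', h0] at h
  have h2 : ‖Complex.liftAux I (mul_self_eq_neg_one_of_norm_eq_one h0 h1) z‖ ^ 2 = ‖z‖ ^ 2 := by
    rw [sq, ← Quaternion.normSq_eq_norm_mul_self, Quaternion.normSq_def', Complex.sq_norm,
      Complex.normSq_apply, Complex.liftAux_apply, Quaternion.algebraMap_def]
    simp [h0]
    nlinarith
  exact (pow_left_inj₀ (norm_nonneg _) (norm_nonneg _) two_ne_zero).1 h2

theorem smul_expQ_eq_liftAux {I : ℍ[ℝ]} (hI : I * I = -1) (r t : ℝ) :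
    r • expQ I t = Complex.liftAux I hI (r * Complex.exp (t * Complex.I)) := by
  rw [Complex.liftAux_apply, expQ, smul_add, smul_smul, smul_smul, Algebra.algebraMap_eq_smul_one]
  simp [Complex.exp_ofReal_mul_I_re, Complex.exp_ofReal_mul_I_im]

theorem norm_smul_expQ {I : ℍ[ℝ]} (h0 : I.re = 0) (h1 : ‖I‖ = 1) (r t : ℝ) :
    ‖r • expQ I t‖ = |r| := by
  rw [smul_expQ_eq_liftAux (mul_self_eq_neg_one_of_norm_eq_one h0 h1),
    norm_liftAux_quaternion h0 h1]
  simp [Complex.norm_exp_ofReal_mul_I]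

theorem thetaOf_smul_expQ {I : ℍ[ℝ]} (h0 : I.re = 0) (h1 : ‖I‖ = 1) {r t : ℝ} (hr : 0 < r)
    (ht : t ∈ Set.Icc 0 Real.pi) : thetaOf (r • expQ I t) = t := by
  rw [thetaOf, norm_smul_expQ h0 h1, abs_of_pos hr]
  simp [expQ, h0]
  rw [mul_div_cancel_left₀ _ hr.ne', Real.arccos_cos ht.1 ht.2]

theorem thetaOf_mem (q : ℍ[ℝ]) : thetaOf q ∈ Set.Icc 0 Real.pi :=
  ⟨Real.arccos_nonneg _, Real.arccos_le_pi _⟩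

theorem measurable_thetaOf : Measurable thetaOf :=
  Real.continuous_arccos.measurable.comp
    (Quaternion.continuous_re.measurable.div continuous_norm.measurable)

/-- The standard real basis of the quaternions, as a family of unit vectors. -/
theorem exists_quaternion_units : ∃ e : Fin 4 → ℍ[ℝ], (∀ k, ‖e k‖ = 1) ∧
    ∀ x : ℍ[ℝ], x = ∑ k, (![x.re, x.imI, x.imJ, x.imK] k : ℝ) • e k := by
  obtain ⟨i, hi⟩ : ∃ i : ℍ[ℝ], i = ⟨0, 1, 0, 0⟩ := ⟨_, rfl⟩
  obtain ⟨j, hj⟩ : ∃ j : ℍ[ℝ], j = ⟨0, 0, 1, 0⟩ := ⟨_, rfl⟩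
  obtain ⟨k, hk⟩ : ∃ k : ℍ[ℝ], k = ⟨0, 0, 0, 1⟩ := ⟨_, rfl⟩
  have h1 : ∀ x : ℍ[ℝ], Quaternion.normSq x = 1 → ‖x‖ = 1 := fun x hx => by
    rwa [Quaternion.normSq_eq_norm_mul_self, ← sq,
      pow_eq_one_iff_of_nonneg (norm_nonneg _) two_ne_zero] at hx
  refine ⟨![1, i, j, k], fun l => h1 _ ?_, fun x => ?_⟩
  · rw [Quaternion.normSq_def']
    fin_cases l <;> simp [hi, hj, hk]
  · rw [Fin.sum_univ_four]
    ext <;> simp <;> simp [hi, hj, hk]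

theorem exists_eq_norm_smul_expQ (q : ℍ[ℝ]) :
    ∃ I : ℍ[ℝ], I.re = 0 ∧ ‖I‖ = 1 ∧ q = ‖q‖ • expQ I (thetaOf q) := by
  have hq : ‖q‖ ^ 2 = q.re ^ 2 + ‖q.im‖ ^ 2 := by
    rw [sq, sq ‖q.im‖, ← Quaternion.normSq_eq_norm_mul_self, ← Quaternion.normSq_eq_norm_mul_self,
      Quaternion.normSq_def', Quaternion.normSq_def']
    simp
    ring
  have hcos : ‖q‖ * Real.cos (thetaOf q) = q.re := by
    have hre : |q.re| ≤ ‖q‖ := abs_le_of_sq_le_sq (by nlinarith [sq_nonneg ‖q.im‖]) (norm_nonneg _)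
    rcases (norm_nonneg q).eq_or_lt with h | h
    · rw [← h] at hre ⊢
      rw [zero_mul, abs_nonpos_iff.1 hre]
    · have := abs_le.1 hre
      rw [thetaOf, Real.cos_arccos (by rw [le_div_iff₀ h]; linarith)
        (by rw [div_le_one h]; linarith)]
      field_simp
  have hsin : ‖q‖ * Real.sin (thetaOf q) = ‖q.im‖ := by
    have h0 := Real.sin_nonneg_of_mem_Icc (thetaOf_mem q)
    refine (pow_left_inj₀ (by positivity) (norm_nonneg _) two_ne_zero).1 ?_
    have := Real.sin_sq_add_cos_sq (thetaOf q)
    rw [← hcos] at hq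
    nlinarith
  obtain ⟨I, h0, h1, h2⟩ : ∃ I : ℍ[ℝ], I.re = 0 ∧ ‖I‖ = 1 ∧ ‖q.im‖ • I = q.im := by
    by_cases h : q.im = 0
    · obtain ⟨I, hI⟩ : ∃ I : ℍ[ℝ], I = ⟨0, 1, 0, 0⟩ := ⟨_, rfl⟩
      refine ⟨I, by rw [hI], ?_, by rw [h, norm_zero, zero_smul]⟩
      rw [← pow_eq_one_iff_of_nonneg (norm_nonneg _) two_ne_zero, sq,
        ← Quaternion.normSq_eq_norm_mul_self, Quaternion.normSq_def', hI]
      norm_num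
    · have hn : ‖q.im‖ ≠ 0 := norm_ne_zero_iff.2 h
      refine ⟨‖q.im‖⁻¹ • q.im, by simp, ?_, by rw [smul_smul, mul_inv_cancel₀ hn, one_smul]⟩
      rw [norm_smul, norm_inv, norm_norm, inv_mul_cancel₀ hn]
  refine ⟨I, h0, h1, ?_⟩
  rw [expQ, smul_add, smul_smul, smul_smul, hcos, hsin, h2]
  ext <;> simp

/-- A quaternionic power series is controlled by the real and imaginary parts of the four complex
power series built from the coordinates of its coefficients. -/
theorem norm_tsum_pow_mul_sq_le {a : ℕ → ℍ[ℝ]} (ha : Summable fun n => ‖a n‖ ^ 2) {q : ℍ[ℝ]}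
    (hq : ‖q‖ < 1) {b : Fin 4 → ℕ → ℝ} (hb : b = ![fun n => (a n).re, fun n => (a n).imI,
      fun n => (a n).imJ, fun n => (a n).imK]) :
    ‖∑' n, q ^ n * a n‖ ^ 2 ≤ 4 * ∑ k : Fin 4,
      ((∑' n, (b k n : ℂ) * (‖q‖ * Complex.exp (thetaOf q * Complex.I)) ^ n).re ^ 2 +
      (∑' n, (-Complex.I * b k n) * (‖q‖ * Complex.exp (thetaOf q * Complex.I)) ^ n).re ^ 2) := by
  obtain ⟨I, h0, h1, hqI⟩ := exists_eq_norm_smul_expQ q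
  have hI := mul_self_eq_neg_one_of_norm_eq_one h0 h1
  set φ := Complex.liftAux I hI with hφ
  set z : ℂ := ‖q‖ * Complex.exp (thetaOf q * Complex.I) with hz
  have hqz : q = φ z := hqI.trans (smul_expQ_eq_liftAux hI _ _)
  have hφn : ∀ w, ‖φ w‖ = ‖w‖ := norm_liftAux_quaternion h0 h1
  have hzn : ‖z‖ < 1 := by rw [← hφn, ← hqz]; exact hq
  have hφc : Continuous φ := by
    have : ⇑φ = φ.toLinearMap := rfl
    rw [this]; exact LinearMap.continuous_of_finiteDimensional _
  obtain ⟨e, hen, hbe⟩ := exists_quaternion_units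
  have hbk : ∀ k n, b k n = ![(a n).re, (a n).imI, (a n).imJ, (a n).imK] k := fun k n => by
    rw [hb]; fin_cases k <;> rfl
  have hae : ∀ n, a n = ∑ k, φ (b k n) * e k := fun n => by
    conv_lhs => rw [hbe (a n)]
    refine Finset.sum_congr rfl fun k _ => ?_
    rw [← hbk, Algebra.smul_def, ← φ.commutes, Complex.coe_algebraMap]
  have hbn : ∀ k n, ‖b k n‖ ^ 2 ≤ ‖a n‖ ^ 2 := fun k n => by
    rw [sq ‖a n‖, ← Quaternion.normSq_eq_norm_mul_self, Quaternion.normSq_def', Real.norm_eq_abs,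
      sq_abs, hb]
    fin_cases k <;> simp <;> nlinarith [sq_nonneg (a n).re, sq_nonneg (a n).imI,
      sq_nonneg (a n).imJ, sq_nonneg (a n).imK]
  have hs : ∀ k, Summable fun n => (b k n : ℂ) * z ^ n := fun k => by
    refine Summable.of_norm_bounded (g := fun n => ‖a n‖ ^ 2 + (‖z‖ ^ 2) ^ n)
      (ha.add (summable_geometric_of_lt_one (by positivity) (by
        nlinarith [norm_nonneg z]))) fun n => ?_
    rw [norm_mul, Complex.norm_real, norm_pow, ← pow_mul, mul_comm 2 n, pow_mul]
    nlinarith [hbn k n, sq_nonneg (‖b k n‖ - ‖z‖ ^ n), sq_nonneg (‖z‖ ^ n), sq_nonneg (‖b k n‖)]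
  have hsum : ∑' n, q ^ n * a n = ∑ k, φ (∑' n, (b k n : ℂ) * z ^ n) * e k := by
    refine HasSum.tsum_eq ?_
    have h := hasSum_sum (s := Finset.univ) fun k _ =>
      (((hs k).hasSum.map φ hφc).mul_right (e k))
    have hfun : (fun n => q ^ n * a n) = fun n => ∑ k, (φ ∘ fun n => (b k n : ℂ) * z ^ n) n * e k := by
      funext n
      rw [hae n, Finset.mul_sum]
      refine Finset.sum_congr rfl fun k _ => ?_
      rw [hqz, Function.comp_apply, ← map_pow, ← mul_assoc, ← map_mul, mul_comm]
    rw [hfun]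
    exact h
  have hI2 : ∀ k, (∑' n, (-Complex.I * b k n) * z ^ n).re = (∑' n, (b k n : ℂ) * z ^ n).im := by
    intro k
    simp_rw [mul_assoc]
    rw [tsum_mul_left]
    simp
  have hle : ‖∑' n, q ^ n * a n‖ ≤ ∑ k, ‖∑' n, (b k n : ℂ) * z ^ n‖ := by
    rw [hsum]
    refine (norm_sum_le _ _).trans (le_of_eq ?_)
    refine Finset.sum_congr rfl fun k _ => ?_
    rw [norm_mul, hen, hφn, mul_one]
  calc _ ≤ (∑ k, ‖∑' n, (b k n : ℂ) * z ^ n‖) ^ 2 := pow_le_pow_left₀ (norm_nonneg _) hle 2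
    _ ≤ 4 * ∑ k, ‖∑' n, (b k n : ℂ) * z ^ n‖ ^ 2 := by
      simpa using sq_sum_le_card_mul_sum_sq (s := (Finset.univ : Finset (Fin 4)))
        (f := fun k => ‖∑' n, (b k n : ℂ) * z ^ n‖)
    _ = _ := by
      congr 1
      refine Finset.sum_congr rfl fun k _ => ?_
      rw [hI2, Complex.sq_norm, Complex.normSq_apply]
      ring

theorem mem_symmBox_smul_expQ {I : ℍ[ℝ]} (h0 : I.re = 0) (h1 : ‖I‖ = 1) {r t : ℝ} (hr : 0 < r)
    (ht : t ∈ Set.Icc 0 Real.pi) {p : ℍ[ℝ]} (hp : ‖p‖ < 1) (hθ : |thetaOf p - t| ≤ 1 - r)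
    (hpr : 1 - ‖p‖ ≤ 2 * (1 - r)) : p ∈ symmBox (r • expQ I t) := by
  obtain ⟨J, hJ0, hJ1, hpJ⟩ := exists_eq_norm_smul_expQ p
  refine ⟨hp, J, thetaOf p, ‖p‖, hJ0, hJ1, thetaOf_mem p, ?_, by linarith, ?_, hpJ⟩
  · rwa [thetaOf_smul_expQ h0 h1 hr ht, norm_smul_expQ h0 h1, abs_of_pos hr]
  · rwa [norm_smul_expQ h0 h1, abs_of_pos hr]

theorem measure_symmBox_smul_expQ_le {μ : Measure ℍ[ℝ]} {C : ℝ}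
    (hC : ∀ q : ℍ[ℝ], q ≠ 0 → ‖q‖ < 1 → μ (symmBox q) ≤ ENNReal.ofReal (C * (1 - ‖q‖)))
    {I : ℍ[ℝ]} (h0 : I.re = 0) (h1 : ‖I‖ = 1) {r : ℝ} (hr : 0 < r) (hr1 : r < 1) (t : ℝ) :
    μ (symmBox (r • expQ I t)) ≤ ENNReal.ofReal (C * (1 - r)) := by
  have hn : ‖r • expQ I t‖ = r := by rw [norm_smul_expQ h0 h1, abs_of_pos hr]
  have := hC (r • expQ I t) (norm_pos_iff.1 (by rw [hn]; exact hr)) (by rwa [hn])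
  rwa [hn] at this

theorem measure_ball_le {μ : Measure ℍ[ℝ]} {C : ℝ} (hC0 : 0 ≤ C)
    (hC : ∀ q : ℍ[ℝ], q ≠ 0 → ‖q‖ < 1 → μ (symmBox q) ≤ ENNReal.ofReal (C * (1 - ‖q‖))) :
    μ {q | ‖q‖ < 1} ≤ ENNReal.ofReal (2 * C) := by
  obtain ⟨I, h0, h1, -⟩ := exists_eq_norm_smul_expQ 0
  have hcov : {q : ℍ[ℝ] | ‖q‖ < 1} ⊆
      ⋃ m ∈ Finset.range 4, symmBox ((1 / 2 : ℝ) • expQ I (m : ℝ)) := by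
    intro p hp
    have hp1 : ‖p‖ < 1 := hp
    have hθ := thetaOf_mem p
    have hπ := Real.pi_lt_d2
    have hπ3 := Real.pi_gt_three
    have key : ∀ m : ℕ, m < 4 → |thetaOf p - m| ≤ 1 / 2 →
        p ∈ ⋃ m ∈ Finset.range 4, symmBox ((1 / 2 : ℝ) • expQ I (m : ℝ)) := fun m hm h => by
      refine Set.mem_biUnion (Finset.mem_coe.2 (Finset.mem_range.2 hm)) ?_
      have hm3 : (m : ℝ) ≤ 3 := by exact_mod_cast Nat.lt_succ_iff.1 hm
      exact mem_symmBox_smul_expQ h0 h1 (by norm_num) ⟨m.cast_nonneg, by linarith⟩ hp1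
        (by linarith) (by linarith [norm_nonneg p])
    have h0 := hθ.1
    have h3 := hθ.2
    rcases le_total (thetaOf p) (1 / 2) with h | h
    · exact key 0 (by norm_num) (abs_le.2 ⟨by push_cast; linarith, by push_cast; linarith⟩)
    rcases le_total (thetaOf p) (3 / 2) with h' | h'
    · exact key 1 (by norm_num) (abs_le.2 ⟨by push_cast; linarith, by push_cast; linarith⟩)
    rcases le_total (thetaOf p) (5 / 2) with h'' | h''
    · exact key 2 (by norm_num) (abs_le.2 ⟨by push_cast; linarith, by push_cast; linarith⟩)
    · exact key 3 (by norm_num) (abs_le.2 ⟨by push_cast; linarith, by push_cast; linarith⟩)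
  calc μ {q | ‖q‖ < 1} ≤ ∑ m ∈ Finset.range 4, μ (symmBox ((1 / 2 : ℝ) • expQ I (m : ℝ))) :=
        (measure_mono hcov).trans (measure_biUnion_finset_le _ _)
    _ ≤ ∑ m ∈ Finset.range 4, ENNReal.ofReal (C * (1 - 1 / 2)) :=
        Finset.sum_le_sum fun m _ =>
          measure_symmBox_smul_expQ_le hC h0 h1 (by norm_num) (by norm_num) _
    _ = ENNReal.ofReal (2 * C) := by
        rw [← ENNReal.ofReal_sum_of_nonneg fun _ _ => by positivity]
        congr 1
        simp
        ring

theorem measure_polar_box_le {μ : Measure ℍ[ℝ]} {C : ℝ} (hC0 : 0 ≤ C)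
    (hC : ∀ q : ℍ[ℝ], q ≠ 0 → ‖q‖ < 1 → μ (symmBox q) ≤ ENNReal.ofReal (C * (1 - ‖q‖)))
    {t : ℝ} (ht : t ∈ Set.Icc 0 Real.pi) {h : ℝ} (hh : 0 < h) :
    μ {p | ‖p‖ < 1 ∧ 1 - ‖p‖ ≤ h ∧ |thetaOf p - t| ≤ h} ≤
      ENNReal.ofReal ((2 * C + 1) * h) := by
  rcases lt_or_ge h 1 with h1 | h1
  · obtain ⟨I, hI0, hI1, -⟩ := exists_eq_norm_smul_expQ 0
    refine (measure_mono fun p hp => mem_symmBox_smul_expQ hI0 hI1 (r := 1 - h) (by linarith) ht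
      hp.1 (by linarith [hp.2.2]) (by linarith [hp.2.1])).trans
        ((measure_symmBox_smul_expQ_le hC hI0 hI1 (by linarith) (by linarith) t).trans
          (ENNReal.ofReal_le_ofReal ?_))
    nlinarith
  · refine (measure_mono fun p hp => hp.1).trans ((measure_ball_le hC0 hC).trans
      (ENNReal.ofReal_le_ofReal ?_))
    nlinarith

theorem sum_quaternion_coords_sq (x : ℍ[ℝ]) :
    ∑ k : Fin 4, (![x.re, x.imI, x.imJ, x.imK] k) ^ 2 = ‖x‖ ^ 2 := by
  rw [sq ‖x‖, ← Quaternion.normSq_eq_norm_mul_self, Quaternion.normSq_def', Fin.sum_univ_four]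
  rfl

theorem setLIntegral_norm_le_of_symmBox {μ : Measure ℍ[ℝ]} {C : ℝ} (hC0 : 0 ≤ C)
    (hC : ∀ q : ℍ[ℝ], q ≠ 0 → ‖q‖ < 1 → μ (symmBox q) ≤ ENNReal.ofReal (C * (1 - ‖q‖)))
    {a : ℕ → ℍ[ℝ]} (ha : Summable fun n => ‖a n‖ ^ 2) {R : ℝ} (hR0 : 0 ≤ R) (hR : R < 1) :
    ∫⁻ q in {q : ℍ[ℝ] | ‖q‖ ≤ R}, (‖∑' n : ℕ, q ^ n * a n‖₊ : ℝ≥0∞) ^ 2 ∂μ ≤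
      ENNReal.ofReal (120000 * (2 * C + 1) * ∑' n : ℕ, ‖a n‖ ^ 2) := by
  set D : ℝ := 2 * C + 1 with hD
  have hD0 : 0 < D := by positivity
  have hms : MeasurableSet {q : ℍ[ℝ] | ‖q‖ ≤ R} := measurableSet_le measurable_norm measurable_const
  set ν := μ.restrict {q : ℍ[ℝ] | ‖q‖ ≤ R} with hν
  obtain ⟨b, hb⟩ : ∃ b : Fin 4 → ℕ → ℝ, b = ![fun n => (a n).re, fun n => (a n).imI,
    fun n => (a n).imJ, fun n => (a n).imK] := ⟨_, rfl⟩
  have hbk : ∀ k n, b k n = ![(a n).re, (a n).imI, (a n).imJ, (a n).imK] k := fun k n => by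
    rw [hb]; fin_cases k <;> rfl
  have hbsum : ∀ n, ∑ k, b k n ^ 2 = ‖a n‖ ^ 2 := fun n => by
    simp_rw [hbk]; exact sum_quaternion_coords_sq _
  have hbs : ∀ k, Summable fun n => b k n ^ 2 := fun k =>
    Summable.of_nonneg_of_le (fun n => sq_nonneg _) (fun n => by
      rw [← hbsum n]
      exact Finset.single_le_sum (f := fun k => b k n ^ 2) (fun _ _ => sq_nonneg _)
        (Finset.mem_univ k)) ha
  set z : ℍ[ℝ] → ℂ := fun q => (min ‖q‖ R : ℝ) * Complex.exp (thetaOf q * Complex.I) with hz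
  have hest : ∀ c : ℕ → ℂ, (Summable fun n => ‖c n‖ ^ 2) →
      ∫⁻ q, ENNReal.ofReal ((∑' n, c n * z q ^ n).re ^ 2) ∂ν ≤
        ENNReal.ofReal (15000 * D * ∑' n, ‖c n‖ ^ 2) := fun c hc => by
    refine lintegral_re_tsum_sq_le (measurable_norm.min measurable_const) measurable_thetaOf hR
      (fun q => le_min (norm_nonneg q) hR0) (fun q => min_le_right _ _) thetaOf_mem hD0 ?_ hc
    intro t ht h hh
    rw [hν, Measure.restrict_apply' hms]
    refine (measure_mono fun p hp => ?_).trans (measure_polar_box_le hC0 hC ht hh)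
    have hpR : ‖p‖ ≤ R := hp.2
    have h1 := hp.1.1
    rw [min_eq_left hpR] at h1
    exact ⟨hpR.trans_lt hR, h1, hp.1.2⟩
  have hI : ∀ k n, ‖-Complex.I * (b k n : ℂ)‖ ^ 2 = b k n ^ 2 := fun k n => by simp
  have hr : ∀ k n, ‖(b k n : ℂ)‖ ^ 2 = b k n ^ 2 := fun k n => by simp
  have hzm : Measurable z := by
    have := measurable_thetaOf
    have h2 : Measurable fun q : ℍ[ℝ] => min ‖q‖ R := measurable_norm.min measurable_const
    exact (Complex.measurable_ofReal.comp h2).mul (by fun_prop)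
  calc ∫⁻ q, (‖∑' n : ℕ, q ^ n * a n‖₊ : ℝ≥0∞) ^ 2 ∂ν
      ≤ ∫⁻ q, 4 * ∑ k : Fin 4, (ENNReal.ofReal ((∑' n, (b k n : ℂ) * z q ^ n).re ^ 2) +
          ENNReal.ofReal ((∑' n, (-Complex.I * b k n) * z q ^ n).re ^ 2)) ∂ν := by
        refine setLIntegral_mono' hms fun q hq => ?_
        have hqR : ‖q‖ ≤ R := hq
        have hzq : z q = ‖q‖ * Complex.exp (thetaOf q * Complex.I) := by
          rw [hz]; simp only [min_eq_left hqR]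
        have h4 : (4 : ℝ≥0∞) = ENNReal.ofReal 4 := by norm_num
        simp_rw [← ENNReal.ofReal_add (sq_nonneg _) (sq_nonneg _)]
        rw [← ENNReal.ofReal_sum_of_nonneg fun _ _ => by positivity, h4,
          ← ENNReal.ofReal_mul (by norm_num), ← ENNReal.ofReal_coe_nnreal,
          ← ENNReal.ofReal_pow NNReal.zero_le_coe, coe_nnnorm, hzq]
        exact ENNReal.ofReal_le_ofReal (norm_tsum_pow_mul_sq_le ha (hqR.trans_lt hR) hb)
    _ ≤ 4 * ∑ k : Fin 4, (ENNReal.ofReal (15000 * D * ∑' n, b k n ^ 2) +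
          ENNReal.ofReal (15000 * D * ∑' n, b k n ^ 2)) := by
        have hm : ∀ c : ℕ → ℂ, Measurable fun q =>
            ENNReal.ofReal ((∑' n, c n * z q ^ n).re ^ 2) := fun c => by
          fun_prop
        rw [lintegral_const_mul' _ _ (by norm_num), lintegral_finsetSum]
        · gcongr with k
          rw [lintegral_add_left (hm _)]
          have e1 := hest (fun n => (b k n : ℂ)) (by simp_rw [hr]; exact hbs k)
          have e2 := hest (fun n => -Complex.I * (b k n : ℂ)) (by simp_rw [hI]; exact hbs k)
          simp_rw [hr] at e1
          simp_rw [hI] at e2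
          exact add_le_add e1 e2
        · exact fun k _ => (hm _).add (hm _)
    _ = ENNReal.ofReal (120000 * D * ∑' n : ℕ, ‖a n‖ ^ 2) := by
        have h4 : (4 : ℝ≥0∞) = ENNReal.ofReal 4 := by norm_num
        have hn : ∀ k, 0 ≤ 15000 * D * ∑' n, b k n ^ 2 := fun k =>
          mul_nonneg (by positivity) (tsum_nonneg fun n => sq_nonneg _)
        have hadd := fun k => ENNReal.ofReal_add (hn k) (hn k)
        simp_rw [← hadd]
        rw [← ENNReal.ofReal_sum_of_nonneg fun k _ => add_nonneg (hn k) (hn k), h4,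
          ← ENNReal.ofReal_mul (by norm_num)]
        congr 1
        simp_rw [← hbsum]
        rw [Summable.tsum_finsetSum fun k _ => hbs k, Finset.mul_sum, Finset.mul_sum]
        exact Finset.sum_congr rfl fun k _ => by ring

theorem setLIntegral_ball_norm_le_of_symmBox {μ : Measure ℍ[ℝ]} {C : ℝ} (hC0 : 0 ≤ C)
    (hC : ∀ q : ℍ[ℝ], q ≠ 0 → ‖q‖ < 1 → μ (symmBox q) ≤ ENNReal.ofReal (C * (1 - ‖q‖)))
    {a : ℕ → ℍ[ℝ]} (ha : Summable fun n => ‖a n‖ ^ 2) :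
    ∫⁻ q in {q : ℍ[ℝ] | ‖q‖ < 1}, (‖∑' n : ℕ, q ^ n * a n‖₊ : ℝ≥0∞) ^ 2 ∂μ ≤
      ENNReal.ofReal (120000 * (2 * C + 1) * ∑' n : ℕ, ‖a n‖ ^ 2) := by
  obtain ⟨u, hu, hu1, hulim⟩ := exists_seq_strictMono_tendsto' (show (0 : ℝ) < 1 by norm_num)
  have hball : {q : ℍ[ℝ] | ‖q‖ < 1} = ⋃ n, {q : ℍ[ℝ] | ‖q‖ ≤ u n} := by
    ext q
    simp only [Set.mem_ofPred_eq, Set.mem_iUnion]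
    refine ⟨fun h => ?_, fun ⟨n, h⟩ => h.trans_lt (hu1 n).2⟩
    obtain ⟨n, hn⟩ := (hulim.eventually (lt_mem_nhds h)).exists
    exact ⟨n, hn.le⟩
  have hmono : Monotone fun n => {q : ℍ[ℝ] | ‖q‖ ≤ u n} := fun m n h q hq =>
    le_trans hq (hu.monotone h)
  rw [hball, setLIntegral_iUnion_of_directed _ hmono.directed_le]
  exact iSup_le fun n => setLIntegral_norm_le_of_symmBox hC0 hC ha (hu1 n).1.le (hu1 n).2

/-- The sum of the Cauchy kernels at `r e^{iθ}` and at its conjugate, as a power series with real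
coefficients. -/
theorem hasSum_two_mul_cos_mul_pow {r θ : ℝ} (hr0 : 0 ≤ r) (hr : r < 1) {z : ℂ} (hz : ‖z‖ < 1) :
    HasSum (fun n : ℕ => ((2 * r ^ n * Real.cos (n * θ) : ℝ) : ℂ) * z ^ n)
      ((1 - z * (r * Complex.exp (-(θ * Complex.I))))⁻¹ +
        (1 - z * (r * Complex.exp (θ * Complex.I)))⁻¹) := by
  have hn : ∀ t : ℝ, ‖z * (r * Complex.exp (t * Complex.I))‖ < 1 := fun t => by
    rw [norm_mul, norm_mul, Complex.norm_exp_ofReal_mul_I, Complex.norm_real, mul_one,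
      Real.norm_eq_abs, abs_of_nonneg hr0]
    nlinarith [norm_nonneg z]
  have hn' : ‖z * (r * Complex.exp (-(θ * Complex.I)))‖ < 1 := by
    have := hn (-θ)
    push_cast at this
    rwa [neg_mul] at this
  have h := (hasSum_geometric_of_norm_lt_one hn').add (hasSum_geometric_of_norm_lt_one (hn θ))
  have hf : (fun n : ℕ => ((2 * r ^ n * Real.cos (n * θ) : ℝ) : ℂ) * z ^ n) = fun n : ℕ =>
      (z * (r * Complex.exp (-(θ * Complex.I)))) ^ n +
        (z * (r * Complex.exp (θ * Complex.I))) ^ n := by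
    funext n
    have h2 := Complex.two_cos (n * θ)
    rw [mul_pow, mul_pow, mul_pow, mul_pow, ← Complex.exp_nat_mul, ← Complex.exp_nat_mul]
    push_cast
    rw [mul_right_comm (2 : ℂ), h2, neg_mul, mul_assoc, mul_neg]
    ring_nf
  rw [hf]
  exact h

theorem inv_le_norm_cauchy_kernels {r θ ϱ α : ℝ} (hr0 : 0 ≤ r) (hr : r < 1)
    (hθ : θ ∈ Set.Icc 0 Real.pi) (hα : α ∈ Set.Icc 0 Real.pi) (hαθ : |α - θ| ≤ 1 - r)
    (hϱ : |ϱ| < 1) (hϱr : 1 - ϱ ≤ 2 * (1 - r)) {z : ℂ} (hz : z = ϱ * Complex.exp (α * Complex.I)) :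
    1 / (6 * (1 - r)) ≤ ‖(1 - z * (r * Complex.exp (-(θ * Complex.I))))⁻¹ +
        (1 - z * (r * Complex.exp (θ * Complex.I)))⁻¹‖ := by
  have hδ : 0 < 1 - r := by linarith
  have hϱ' := abs_lt.1 hϱ
  have hzn : ‖z‖ = |ϱ| := by rw [hz, norm_mul, Complex.norm_exp_ofReal_mul_I]; simp
  set A : ℂ := 1 - z * (r * Complex.exp (-(θ * Complex.I))) with hA
  set B : ℂ := 1 - z * (r * Complex.exp (θ * Complex.I)) with hB
  set N : ℂ := 1 - z * (r * Real.cos θ) with hN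
  have hsum : A + B = 2 * N := by
    have h2 := Complex.two_cos θ
    rw [hA, hB, hN, Complex.ofReal_cos]
    rw [neg_mul] at h2
    linear_combination (z * r) * h2
  have hcos := abs_le.2 ⟨Real.neg_one_le_cos θ, Real.cos_le_one θ⟩
  have hN1 : 1 - r ≤ ‖N‖ := by
    have h1 : ‖z * (r * Real.cos θ)‖ ≤ r := by
      rw [norm_mul, hzn, ← Complex.ofReal_mul, Complex.norm_real, norm_mul, Real.norm_eq_abs,
        Real.norm_eq_abs, abs_of_nonneg hr0]
      calc |ϱ| * (r * |Real.cos θ|) ≤ 1 * (r * 1) := by gcongr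
        _ = r := by ring
    have h2 := norm_sub_norm_le (1 : ℂ) (z * (r * Real.cos θ))
    rw [norm_one] at h2
    linarith
  have hsinα := Real.sin_nonneg_of_mem_Icc hα
  have hsinθ := Real.sin_nonneg_of_mem_Icc hθ
  have hN2 : Real.sin α ≤ ‖N‖ := by
    refine abs_le_of_sq_le_sq' ?_ (norm_nonneg _) |>.2
    have hre : N.re = 1 - ϱ * r * Real.cos θ * Real.cos α := by
      rw [hN, hz, ← Complex.ofReal_mul]
      simp [Complex.exp_ofReal_mul_I_re, -Complex.ofReal_mul, -Complex.ofReal_cos]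
      ring
    have him : N.im = - (ϱ * r * Real.cos θ * Real.sin α) := by
      rw [hN, hz, ← Complex.ofReal_mul]
      simp [Complex.exp_ofReal_mul_I_im, -Complex.ofReal_mul, -Complex.ofReal_cos]
      ring
    rw [Complex.sq_norm, Complex.normSq_apply, hre, him]
    nlinarith [Real.sin_sq_add_cos_sq α, sq_nonneg (Real.cos α - ϱ * r * Real.cos θ)]
  have hsin : Real.sin θ ≤ 2 * ‖N‖ := by
    have h1 := Real.abs_sin_sub_sin_le α θ
    have := (abs_le.1 (h1.trans hαθ)).1
    linarith
  have hBN : ‖B‖ ≤ 3 * ‖N‖ := by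
    have h1 : B = N - z * (r * Real.sin θ) * Complex.I := by
      rw [hB, hN, Complex.exp_mul_I, Complex.ofReal_cos, Complex.ofReal_sin]
      ring
    have h2 : ‖z * (r * Real.sin θ) * Complex.I‖ ≤ Real.sin θ := by
      rw [norm_mul, norm_mul, hzn, ← Complex.ofReal_mul, Complex.norm_real, norm_mul,
        Real.norm_eq_abs, Real.norm_eq_abs, abs_of_nonneg hr0, abs_of_nonneg hsinθ, Complex.norm_I]
      calc |ϱ| * (r * Real.sin θ) * 1 ≤ 1 * (1 * Real.sin θ) * 1 := by gcongr
        _ = Real.sin θ := by ring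
    rw [h1]
    linarith [norm_sub_le N (z * (r * Real.sin θ) * Complex.I)]
  have hA4 : ‖A‖ ≤ 4 * (1 - r) := by
    have h1 : A = ((1 - ϱ * r : ℝ) : ℂ) -
        ((ϱ * r : ℝ) : ℂ) * (Complex.exp (Complex.I * (α - θ : ℝ)) - 1) := by
      have : Complex.exp (Complex.I * (α - θ : ℝ)) =
          Complex.exp (α * Complex.I) * Complex.exp (-(θ * Complex.I)) := by
        rw [← Complex.exp_add]; push_cast; ring_nf
      rw [hA, hz, this]
      push_cast
      ring
    have h2 : ‖((ϱ * r : ℝ) : ℂ) * (Complex.exp (Complex.I * (α - θ : ℝ)) - 1)‖ ≤ 1 - r := by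
      rw [norm_mul, Complex.norm_real, norm_mul, Real.norm_eq_abs, Real.norm_eq_abs,
        abs_of_nonneg hr0]
      have h3 := (Real.norm_exp_I_mul_ofReal_sub_one_le (x := α - θ)).trans hαθ
      calc _ ≤ 1 * 1 * (1 - r) := by gcongr
        _ = _ := by ring
    have h4 : ‖((1 - ϱ * r : ℝ) : ℂ)‖ ≤ 3 * (1 - r) := by
      rw [Complex.norm_real, Real.norm_eq_abs, abs_le]
      constructor <;> nlinarith
    rw [h1]
    linarith [norm_sub_le ((1 - ϱ * r : ℝ) : ℂ)
      (((ϱ * r : ℝ) : ℂ) * (Complex.exp (Complex.I * (α - θ : ℝ)) - 1))]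
  have hne : ∀ t : ℂ, ‖Complex.exp t‖ = 1 → 0 < ‖1 - z * (r * Complex.exp t)‖ := fun t ht => by
    have h1 : ‖z * (r * Complex.exp t)‖ ≤ r := by
      rw [norm_mul, norm_mul, ht, hzn, Complex.norm_real, Real.norm_eq_abs, abs_of_nonneg hr0]
      nlinarith
    have h2 := norm_sub_norm_le (1 : ℂ) (z * (r * Complex.exp t))
    rw [norm_one] at h2
    linarith
  have hA0 : 0 < ‖A‖ := hne _ (by
    have := Complex.norm_exp_ofReal_mul_I (-θ); push_cast at this; rwa [neg_mul] at this)
  have hB0 : 0 < ‖B‖ := hne _ (Complex.norm_exp_ofReal_mul_I θ)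
  have hsum' : A⁻¹ + B⁻¹ = 2 * N / (A * B) := by
    rw [inv_add_inv (norm_pos_iff.1 hA0) (norm_pos_iff.1 hB0), hsum]
  rw [hsum', norm_div, norm_mul, norm_mul, Complex.norm_ofNat,
    div_le_div_iff₀ (by positivity) (by positivity)]
  have hN0 : 0 < ‖N‖ := by linarith
  calc 1 * (‖A‖ * ‖B‖) ≤ 1 * ((4 * (1 - r)) * (3 * ‖N‖)) := by gcongr
    _ = 2 * ‖N‖ * (6 * (1 - r)) := by ring

theorem measure_symmBox_le_of_carleson {μ : Measure ℍ[ℝ]} {c : ℝ} (hc0 : 0 ≤ c)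
    (hc : ∀ a : ℕ → ℍ[ℝ], Summable (fun n => ‖a n‖ ^ 2) →
      ∫⁻ q in {q : ℍ[ℝ] | ‖q‖ < 1}, (‖∑' n : ℕ, q ^ n * a n‖₊ : ℝ≥0∞) ^ 2 ∂μ
        ≤ ENNReal.ofReal (c * ∑' n : ℕ, ‖a n‖ ^ 2)) {q : ℍ[ℝ]} (hq : ‖q‖ < 1) :
    μ (symmBox q) ≤ ENNReal.ofReal (144 * c * (1 - ‖q‖)) := by
  set r := ‖q‖ with hr
  have hr0 : 0 ≤ r := norm_nonneg q
  have hδ : 0 < 1 - r := by linarith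
  set a : ℕ → ℍ[ℝ] := fun n => ((2 * r ^ n * Real.cos (n * thetaOf q) : ℝ) : ℍ[ℝ]) with ha
  have han : ∀ n, ‖a n‖ ^ 2 ≤ 4 * r ^ n := fun n => by
    rw [ha]
    simp only
    rw [Quaternion.norm_coe, Real.norm_eq_abs, sq_abs, mul_pow, mul_pow]
    have h1 := Real.cos_sq_le_one (n * thetaOf q)
    have h2 : r ^ n ≤ 1 := pow_le_one₀ hr0 hq.le
    have h3 : 0 ≤ r ^ n := by positivity
    calc 2 ^ 2 * (r ^ n) ^ 2 * Real.cos (n * thetaOf q) ^ 2 ≤ 2 ^ 2 * (r ^ n) ^ 2 * 1 := by gcongr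
      _ ≤ 4 * r ^ n := by nlinarith
  have hgeom : HasSum (fun n => 4 * r ^ n) (4 * (1 - r)⁻¹) :=
    (hasSum_geometric_of_lt_one hr0 hq).mul_left 4
  have has : Summable fun n => ‖a n‖ ^ 2 :=
    Summable.of_nonneg_of_le (fun n => by positivity) han hgeom.summable
  have hasum : ∑' n, ‖a n‖ ^ 2 ≤ 4 * (1 - r)⁻¹ :=
    (has.tsum_le_tsum han hgeom.summable).trans hgeom.tsum_eq.le
  have hlow : ∀ p ∈ symmBox q, 1 / (6 * (1 - r)) ≤ ‖∑' n : ℕ, p ^ n * a n‖ := by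
    rintro p ⟨hp, I, α, ϱ, hI0, hI1, hα, hαθ, -, hϱr, rfl⟩
    rw [norm_smul_expQ hI0 hI1] at hp
    have hI := mul_self_eq_neg_one_of_norm_eq_one hI0 hI1
    set z : ℂ := ϱ * Complex.exp (α * Complex.I) with hz
    have hzn : ‖z‖ < 1 := by
      rw [hz, norm_mul, Complex.norm_exp_ofReal_mul_I]; simpa using hp
    set φ := Complex.liftAux I hI with hφ
    have hφc : Continuous φ := by
      have : ⇑φ = φ.toLinearMap := rfl
      rw [this]; exact LinearMap.continuous_of_finiteDimensional _
    have hs := (hasSum_two_mul_cos_mul_pow hr0 hq hzn (θ := thetaOf q)).map φ hφc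
    have hf : (fun n => (ϱ • expQ I α) ^ n * a n) = φ ∘ fun n : ℕ =>
        ((2 * r ^ n * Real.cos (n * thetaOf q) : ℝ) : ℂ) * z ^ n := by
      funext n
      rw [Function.comp_apply, mul_comm, map_mul, map_pow, smul_expQ_eq_liftAux hI,
        ← Complex.coe_algebraMap, φ.commutes]
      rfl
    rw [hf, hs.tsum_eq, norm_liftAux_quaternion hI0 hI1]
    exact inv_le_norm_cauchy_kernels hr0 hq (thetaOf_mem q) hα hαθ hp hϱr hz
  set ε : ℝ≥0∞ := ENNReal.ofReal (1 / (36 * (1 - r) ^ 2)) with hε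
  have hms : MeasurableSet {q : ℍ[ℝ] | ‖q‖ < 1} := measurableSet_lt measurable_norm measurable_const
  have hmf : Measurable fun p : ℍ[ℝ] => (‖∑' n : ℕ, p ^ n * a n‖₊ : ℝ≥0∞) ^ 2 := by
    have : Measurable fun p : ℍ[ℝ] => ∑' n : ℕ, p ^ n * a n :=
      Measurable.tsum fun n => (by fun_prop : Continuous fun p : ℍ[ℝ] => p ^ n * a n).measurable
    exact this.nnnorm.coe_nnreal_ennreal.pow_const 2
  have hbox : ε * μ (symmBox q) ≤ ENNReal.ofReal (c * (4 * (1 - r)⁻¹)) := by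
    calc ε * μ (symmBox q) ≤ ε * (μ.restrict {q : ℍ[ℝ] | ‖q‖ < 1})
          {p | ε ≤ (‖∑' n : ℕ, p ^ n * a n‖₊ : ℝ≥0∞) ^ 2} := by
          rw [Measure.restrict_apply' hms]
          gcongr
          intro p hp
          refine ⟨?_, hp.1⟩
          have h := hlow p hp
          change ε ≤ (‖∑' n : ℕ, p ^ n * a n‖₊ : ℝ≥0∞) ^ 2
          rw [hε, ← ENNReal.ofReal_coe_nnreal, ← ENNReal.ofReal_pow NNReal.zero_le_coe, coe_nnnorm]
          refine ENNReal.ofReal_le_ofReal ((le_of_eq ?_).trans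
            (pow_le_pow_left₀ (by positivity) h 2))
          field_simp
          norm_num
      _ ≤ _ := (mul_meas_ge_le_lintegral hmf ε).trans ((hc a has).trans
          (ENNReal.ofReal_le_ofReal (mul_le_mul_of_nonneg_left hasum hc0)))
  have hεinv : ENNReal.ofReal (36 * (1 - r) ^ 2) * ε = 1 := by
    rw [hε, ← ENNReal.ofReal_mul (by positivity), mul_one_div_cancel (by positivity),
      ENNReal.ofReal_one]
  calc μ (symmBox q) = ENNReal.ofReal (36 * (1 - r) ^ 2) * (ε * μ (symmBox q)) := by
        rw [← mul_assoc, hεinv, one_mul]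
    _ ≤ ENNReal.ofReal (36 * (1 - r) ^ 2) * ENNReal.ofReal (c * (4 * (1 - r)⁻¹)) := by gcongr
    _ = ENNReal.ofReal (144 * c * (1 - r)) := by
        rw [← ENNReal.ofReal_mul (by positivity)]
        congr 1
        field_simp
        ring

/-- **Carleson measures for the quaternionic Hardy space `H²(𝔹)`.**
A nonnegative Borel measure `μ` on the quaternionic unit ball is a Carleson measure for
`H²(𝔹)` (i.e. `∫_𝔹 |f|² dμ ≤ c(μ)‖f‖²_{H²}` for every `f(q) = ∑ qⁿ aₙ` with
`∑|aₙ|² < ∞`) if and only if there is a constant `C` with `μ(S(q)) ≤ C·(1 − |q|)` for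
every `q ∈ 𝔹`, `q ≠ 0`. -/
theorem carleson_iff_symmBox (μ : Measure ℍ[ℝ]) :
    (∃ c : ℝ, 0 ≤ c ∧ ∀ a : ℕ → ℍ[ℝ], Summable (fun n => ‖a n‖ ^ 2) →
      ∫⁻ q in {q : ℍ[ℝ] | ‖q‖ < 1}, (‖∑' n : ℕ, q ^ n * a n‖₊ : ℝ≥0∞) ^ 2 ∂μ
        ≤ ENNReal.ofReal (c * ∑' n : ℕ, ‖a n‖ ^ 2)) ↔
    (∃ C : ℝ, 0 ≤ C ∧ ∀ q : ℍ[ℝ], q ≠ 0 → ‖q‖ < 1 →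
      μ (symmBox q) ≤ ENNReal.ofReal (C * (1 - ‖q‖))) := by
  constructor
  · rintro ⟨c, hc0, hc⟩
    exact ⟨144 * c, by positivity, fun q _ hq => measure_symmBox_le_of_carleson hc0 hc hq⟩
  · rintro ⟨C, hC0, hC⟩
    exact ⟨120000 * (2 * C + 1), by positivity,
      fun a ha => setLIntegral_ball_norm_le_of_symmBox hC0 hC ha⟩
end

section
/- Let u, v ∈ ℝ with u² + v² < 1 and let q ∈ 𝔹. Then for every J ∈ 𝕊 one has (1/(4π)) ∫_{𝕊} k_{u+vI}(q) dA_𝕊(I) = (1/2)·( k_{u+vJ}(q) + k_{u−vJ}(q) ), where the integral is taken with respect to the surface area measure dA_𝕊 on the 2-sphere 𝕊 (of total area 4π). In particular the spherical average of the reproducing kernels k_{u+vI} over I ∈ 𝕊 is independent of the point on the sphere u + v𝕊 and equals (1/2)(k_w + k_{w̄}) for any w = u + vJ. -/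
open scoped Quaternion ENNReal
open MeasureTheory

/-- The reproducing kernel of the quaternionic Hardy space `H²(𝔹)`:
`k_w(q) = ∑ₙ qⁿ·w̄ⁿ`. -/
noncomputable def hardyKernel (w q : ℍ[ℝ]) : ℍ[ℝ] := ∑' n : ℕ, q ^ n * (star w) ^ n

/-- The identification of `ℝ³` with the imaginary quaternions. -/
def iQ (v : EuclideanSpace ℝ (Fin 3)) : ℍ[ℝ] := ⟨0, v 0, v 1, v 2⟩

@[simp] theorem re_iQ (x : EuclideanSpace ℝ (Fin 3)) : (iQ x).re = 0 := rfl

@[simp] theorem imI_iQ (x : EuclideanSpace ℝ (Fin 3)) : (iQ x).imI = x 0 := rfl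

@[simp] theorem imJ_iQ (x : EuclideanSpace ℝ (Fin 3)) : (iQ x).imJ = x 1 := rfl

@[simp] theorem imK_iQ (x : EuclideanSpace ℝ (Fin 3)) : (iQ x).imK = x 2 := rfl

theorem iQ_mul_self (x : EuclideanSpace ℝ (Fin 3)) (hx : ‖x‖ = 1) : iQ x * iQ x = -1 := by
  have h : x 0 ^ 2 + x 1 ^ 2 + x 2 ^ 2 = 1 := by
    have := EuclideanSpace.real_norm_sq_eq x
    rw [hx, Fin.sum_univ_three] at this
    linarith
  ext <;> simp <;> linarith

theorem star_iQ (x : EuclideanSpace ℝ (Fin 3)) : star (iQ x) = -iQ x := by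
  ext <;> simp

theorem iQ_neg (x : EuclideanSpace ℝ (Fin 3)) : iQ (-x) = -iQ x := by
  ext <;> simp

/-- `iQ` as a linear map. -/
def iQLinearMap : EuclideanSpace ℝ (Fin 3) →ₗ[ℝ] ℍ[ℝ] where
  toFun := iQ
  map_add' x y := by ext <;> simp
  map_smul' c x := by ext <;> simp

theorem continuous_iQ : Continuous iQ :=
  iQLinearMap.continuous_of_finiteDimensional

/-- The sum `∑ₙ qⁿ Re(zⁿ)`. -/
noncomputable def kernelRe (z : ℂ) (q : ℍ[ℝ]) : ℍ[ℝ] := ∑' n : ℕ, (z ^ n).re • q ^ n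

/-- The sum `∑ₙ qⁿ Im(zⁿ)`. -/
noncomputable def kernelIm (z : ℂ) (q : ℍ[ℝ]) : ℍ[ℝ] := ∑' n : ℕ, (z ^ n).im • q ^ n

theorem summable_smul_pow {c : ℕ → ℝ} {z : ℂ} (hz : ‖z‖ < 1) (hc : ∀ n, |c n| ≤ ‖z ^ n‖)
    {q : ℍ[ℝ]} (hq : ‖q‖ < 1) : Summable fun n : ℕ => c n • q ^ n := by
  refine Summable.of_norm_bounded (summable_geometric_of_lt_one (norm_nonneg q) hq) fun n => ?_
  rw [norm_smul, norm_pow, Real.norm_eq_abs]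
  have h : |c n| ≤ 1 := (hc n).trans (by rw [norm_pow]; exact pow_le_one₀ (norm_nonneg z) hz.le)
  exact mul_le_of_le_one_left (by positivity) h

/-- The representation formula for the kernel on the sphere `u + v𝕊`. -/
theorem hardyKernel_eq {u v : ℝ} (huv : u ^ 2 + v ^ 2 < 1) {q : ℍ[ℝ]} (hq : ‖q‖ < 1)
    {I : ℍ[ℝ]} (hI : I * I = -1) (hIs : star I = -I) :
    hardyKernel ((u : ℍ[ℝ]) + v • I) q = kernelRe ⟨u, v⟩ q - kernelIm ⟨u, v⟩ q * I := by
  have hz : ‖(⟨u, v⟩ : ℂ)‖ < 1 := by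
    rw [← sq_lt_one_iff₀ (norm_nonneg _), Complex.sq_norm, Complex.normSq_mk]
    linarith
  have hpow (n : ℕ) : star ((u : ℍ[ℝ]) + v • I) ^ n
      = (((⟨u, v⟩ : ℂ) ^ n).re : ℍ[ℝ]) - ((⟨u, v⟩ : ℂ) ^ n).im • I := by
    have hI' : -I * -I = -1 := by rw [neg_mul_neg, hI]
    have h := map_pow (Complex.liftAux (-I) hI') ⟨u, v⟩ n
    simp only [Complex.liftAux_apply, Quaternion.algebraMap_def] at h
    rw [star_add, Quaternion.star_smul, hIs, Quaternion.star_coe, ← h, smul_neg, sub_eq_add_neg]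
  have hre := summable_smul_pow hz (fun n => Complex.abs_re_le_norm ((⟨u, v⟩ : ℂ) ^ n)) hq
  have him := summable_smul_pow hz (fun n => Complex.abs_im_le_norm ((⟨u, v⟩ : ℂ) ^ n)) hq
  rw [hardyKernel, kernelRe, kernelIm, ← him.tsum_mul_right, ← hre.tsum_sub (him.mul_right I)]
  refine tsum_congr fun n => ?_
  rw [hpow, mul_sub, Quaternion.mul_coe_eq_smul, mul_smul_comm, smul_mul_assoc]

theorem measurePreserving_neg_toSphere {E : Type*} [NormedAddCommGroup E] [NormedSpace ℝ E]
    [MeasurableSpace E] [BorelSpace E] (μ : Measure E) [μ.IsNegInvariant] :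
    MeasurePreserving (fun x : Metric.sphere (0 : E) 1 => -x) μ.toSphere μ.toSphere := by
  have hm : Measurable fun x : Metric.sphere (0 : E) 1 => -x := continuous_neg.measurable
  refine ⟨hm, Measure.ext fun s hs => ?_⟩
  rw [Measure.map_apply hm hs, Measure.toSphere_apply' _ (hm hs), Measure.toSphere_apply' _ hs]
  have h : ((↑) '' ((fun x : Metric.sphere (0 : E) 1 => -x) ⁻¹' s) : Set E) = -((↑) '' s) := by
    ext x
    simp only [Set.mem_image, Set.mem_preimage, Set.mem_neg]
    constructor
    · rintro ⟨y, hy, rfl⟩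
      exact ⟨-y, hy, rfl⟩
    · rintro ⟨y, hy, h⟩
      exact ⟨-y, by simpa using hy, by simp [h]⟩
  rw [h, Set.smul_neg, Measure.measure_neg]

theorem toSphere_real_univ_fin_three :
    (volume : Measure (EuclideanSpace ℝ (Fin 3))).toSphere.real Set.univ = 4 * Real.pi := by
  rw [Measure.toSphere_real_apply_univ, measureReal_def, EuclideanSpace.volume_ball_fin_three]
  have := Real.pi_pos
  simp
  rw [ENNReal.toReal_ofReal (by positivity)]
  ring

/-- **Spherical average of reproducing kernels.**
For `u, v ∈ ℝ` with `u² + v² < 1`, `q ∈ 𝔹` and any imaginary unit `J`,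
`(1/(4π)) ∫_𝕊 k_{u+vI}(q) dA_𝕊(I) = (1/2)(k_{u+vJ}(q) + k_{u−vJ}(q))`,
where `dA_𝕊` is the surface area measure on the 2-sphere `𝕊` of imaginary units
(realized as the unit sphere of `ℝ³`, with total area `4π`). In particular the
average is independent of the choice of `J`. -/
theorem spherical_average_of_kernels (u v : ℝ) (huv : u ^ 2 + v ^ 2 < 1)
    (q : ℍ[ℝ]) (hq : ‖q‖ < 1) (J : ℍ[ℝ]) (hJre : J.re = 0) (hJnorm : ‖J‖ = 1) :
    (1 / (4 * Real.pi)) •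
        ∫ I : Metric.sphere (0 : EuclideanSpace ℝ (Fin 3)) 1,
          hardyKernel ((u : ℍ[ℝ]) + v • iQ (I : EuclideanSpace ℝ (Fin 3))) q
          ∂((volume : Measure (EuclideanSpace ℝ (Fin 3))).toSphere)
      = (1 / 2 : ℝ) •
          (hardyKernel ((u : ℍ[ℝ]) + v • J) q + hardyKernel ((u : ℍ[ℝ]) - v • J) q) := by
  have hJs : star J = -J := by
    ext <;> simp [hJre]
  have hJ : J * J = -1 := by
    have h := Quaternion.self_mul_star J
    rw [hJs, mul_neg, Quaternion.normSq_eq_norm_mul_self, hJnorm] at h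
    simpa using congrArg Neg.neg h
  have hnJ : hardyKernel ((u : ℍ[ℝ]) - v • J) q
      = kernelRe ⟨u, v⟩ q - kernelIm ⟨u, v⟩ q * -J := by
    rw [← hardyKernel_eq huv hq (by rw [neg_mul_neg, hJ]) (by rw [star_neg, hJs]), smul_neg,
      sub_eq_add_neg]
  set σ := (volume : Measure (EuclideanSpace ℝ (Fin 3))).toSphere
  have hcont : Continuous fun I : Metric.sphere (0 : EuclideanSpace ℝ (Fin 3)) 1 =>
      kernelIm ⟨u, v⟩ q * iQ I :=
    continuous_const.mul (continuous_iQ.comp continuous_subtype_val)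
  have hodd : ∫ I : Metric.sphere (0 : EuclideanSpace ℝ (Fin 3)) 1,
      kernelIm ⟨u, v⟩ q * iQ I ∂σ = 0 := by
    have h := (measurePreserving_neg_toSphere
      (volume : Measure (EuclideanSpace ℝ (Fin 3)))).integral_comp
      (Homeomorph.neg (Metric.sphere (0 : EuclideanSpace ℝ (Fin 3)) 1)).measurableEmbedding
      (fun I => kernelIm ⟨u, v⟩ q * iQ I)
    have hneg (I : Metric.sphere (0 : EuclideanSpace ℝ (Fin 3)) 1) :
        kernelIm ⟨u, v⟩ q * iQ (Homeomorph.neg _ I : Metric.sphere _ _)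
          = -(kernelIm ⟨u, v⟩ q * iQ I) := by
      rw [← mul_neg, ← iQ_neg]
      rfl
    have h' := (integral_congr_ae (.of_forall hneg)).symm.trans h
    rw [integral_neg] at h'
    have : IsAddTorsionFree ℍ[ℝ] := .of_module_rat ℍ[ℝ]
    exact neg_eq_self.mp h'
  have hint : ∫ I : Metric.sphere (0 : EuclideanSpace ℝ (Fin 3)) 1,
      hardyKernel ((u : ℍ[ℝ]) + v • iQ I) q ∂σ = (4 * Real.pi) • kernelRe ⟨u, v⟩ q := by
    rw [integral_congr_ae (.of_forall fun I : Metric.sphere (0 : EuclideanSpace ℝ (Fin 3)) 1 =>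
        hardyKernel_eq huv hq (iQ_mul_self I (norm_eq_of_mem_sphere I)) (star_iQ I)),
      integral_sub (integrable_const _)
        (hcont.integrable_of_hasCompactSupport (HasCompactSupport.of_compactSpace _)),
      hodd, sub_zero, integral_const, toSphere_real_univ_fin_three]
  rw [hint, hnJ, hardyKernel_eq huv hq hJ hJs, smul_smul,
    one_div_mul_cancel (by positivity), one_smul, mul_neg, sub_neg_eq_add, sub_add_add_cancel,
    ← two_smul ℝ, smul_smul]
  norm_num
end

section
/- There exists a constant c > 0 with the following property: for every w ∈ 𝔹 with w ≠ 0 and every q in the symmetric box S(w), one has |(1/2)·( k_w(q) + k_{w̄}(q) )| ≥ c / (1 − |w|²). -/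
open scoped Quaternion ENNReal

lemma summable_pow_mul_pow {q v : ℍ[ℝ]} (hq : ‖q‖ < 1) (hv : ‖v‖ < 1) :
    Summable fun n : ℕ => q ^ n * v ^ n := by
  apply Summable.of_norm
  have h : ‖q‖ * ‖v‖ < 1 := by nlinarith [norm_nonneg q, norm_nonneg v]
  refine (summable_geometric_of_lt_one (by positivity) h).congr fun n => ?_
  rw [norm_mul, norm_pow, norm_pow, mul_pow]

lemma tsum_pow_mul_pow_eq {q v : ℍ[ℝ]} (hq : ‖q‖ < 1) (hv : ‖v‖ < 1) :
    ∑' n : ℕ, q ^ n * v ^ n = 1 + q * (∑' n : ℕ, q ^ n * v ^ n) * v := by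
  have hs := summable_pow_mul_pow hq hv
  conv_lhs => rw [hs.tsum_eq_zero_add]
  rw [← hs.tsum_mul_left, ← (hs.mul_left q).tsum_mul_right]
  simp only [pow_zero, mul_one]
  congr 2
  ext1 n
  rw [pow_succ', pow_succ]
  simp only [mul_assoc]

/-- The characteristic polynomial of `v`, evaluated at `q`, clears the denominator of a solution of
`K = 1 + q K v`. -/
lemma charpoly_mul_of_fixed {q v K : ℍ[ℝ]} (hK : K = 1 + q * K * v) :
    (1 - (2 * v.re) • q + (‖v‖ ^ 2) • (q * q)) * K = 1 - q * star v := by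
  have h1 : (2 * v.re) • (q * K) = q * K * v + q * K * star v := by
    rw [← mul_add, Quaternion.self_add_star, ← Quaternion.mul_coe_eq_smul]
    push_cast
    rfl
  have h2 : (‖v‖ ^ 2) • (q * q * K) = q * (q * K * v) * star v := by
    have : v * star v = ((‖v‖ ^ 2 : ℝ) : ℍ[ℝ]) := by
      rw [Quaternion.self_mul_star, Quaternion.normSq_eq_norm_mul_self, sq]
    rw [← Quaternion.mul_coe_eq_smul, ← this]
    simp only [mul_assoc]
  have h3 : q * K * v = K - 1 := by rw [eq_sub_iff_add_eq, add_comm]; exact hK.symm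
  rw [add_mul, sub_mul, smul_mul_assoc, smul_mul_assoc, h1, h2, h3]
  noncomm_ring

/-- The averaged kernel in closed form. -/
lemma charpoly_mul_average {q w : ℍ[ℝ]} (hq : ‖q‖ < 1) (hw : ‖w‖ < 1) :
    (1 - (2 * w.re) • q + (‖w‖ ^ 2) • (q * q)) *
      ((1 / 2 : ℝ) • (hardyKernel w q + hardyKernel (star w) q)) = 1 - w.re • q := by
  have hw' : ‖star w‖ < 1 := by rwa [norm_star]
  have h1 := charpoly_mul_of_fixed (tsum_pow_mul_pow_eq hq hw)
  have h2 := charpoly_mul_of_fixed (tsum_pow_mul_pow_eq hq hw')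
  rw [norm_star, Quaternion.re_star, star_star] at h2
  have h3 : q * star w + q * w = (2 * w.re) • q := by
    rw [← mul_add, Quaternion.star_add_self, ← Quaternion.mul_coe_eq_smul]
    push_cast
    rfl
  unfold hardyKernel
  rw [mul_smul_comm, mul_add, star_star, h1, h2]
  have h4 : (1 - q * star w) + (1 - q * w) = (2 : ℝ) • (1 : ℍ[ℝ]) - (2 * w.re) • q := by
    rw [← h3, two_smul]; abel
  rw [add_comm, h4]
  module

section ImaginaryUnit

variable {I : ℍ[ℝ]}

lemma normSq_smul_one_add_smul (hre : I.re = 0) (hn : ‖I‖ = 1) (x y : ℝ) :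
    ‖x • (1 : ℍ[ℝ]) + y • I‖ ^ 2 = x ^ 2 + y ^ 2 := by
  have h : I.imI ^ 2 + I.imJ ^ 2 + I.imK ^ 2 = 1 := by
    have := Quaternion.normSq_eq_norm_mul_self I
    rw [Quaternion.normSq_def', hre, hn] at this
    linarith
  rw [sq, ← Quaternion.normSq_eq_norm_mul_self, Quaternion.normSq_def']
  simp [hre]
  linear_combination y ^ 2 * h

lemma imaginary_mul_self (hre : I.re = 0) (hn : ‖I‖ = 1) : I * I = -1 := by
  have h := Quaternion.self_mul_star I
  rw [Quaternion.normSq_eq_norm_mul_self, hn, Quaternion.star_eq_neg.mpr hre] at h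
  rw [← neg_eq_iff_eq_neg, ← mul_neg, h]
  simp

lemma norm_expQ (hre : I.re = 0) (hn : ‖I‖ = 1) (α : ℝ) : ‖expQ I α‖ = 1 := by
  have h := normSq_smul_one_add_smul hre hn (Real.cos α) (Real.sin α)
  rw [Real.cos_sq_add_sin_sq] at h
  exact (pow_eq_one_iff_of_nonneg (norm_nonneg _) two_ne_zero).mp h

lemma expQ_mul_expQ (hre : I.re = 0) (hn : ‖I‖ = 1) (α β : ℝ) :
    expQ I α * expQ I β = expQ I (α + β) := by
  simp only [expQ, mul_add, add_mul, smul_mul_smul_comm, mul_one, one_mul,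
    imaginary_mul_self hre hn, Real.cos_add, Real.sin_add]
  module

/-- The characteristic polynomial of a quaternion with modulus `r` and angle `θ` splits over the
slice of `I`. -/
lemma charpoly_expQ_eq (hre : I.re = 0) (hn : ‖I‖ = 1) (r θ ρ α : ℝ) :
    1 - (2 * (r * Real.cos θ)) • (ρ • expQ I α) + (r ^ 2) • (ρ • expQ I α * ρ • expQ I α) =
      (1 - (r * ρ) • expQ I (α - θ)) * (1 - (r * ρ) • expQ I (α + θ)) := by
  have h1 : expQ I (α - θ) + expQ I (α + θ) = (2 * Real.cos θ) • expQ I α := by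
    simp only [expQ, Real.cos_add, Real.sin_add, Real.cos_sub, Real.sin_sub]
    module
  have h2 : expQ I (α - θ) * expQ I (α + θ) = expQ I α * expQ I α := by
    rw [expQ_mul_expQ hre hn, expQ_mul_expQ hre hn]
    ring_nf
  have h3 : (2 * (r * Real.cos θ)) • (ρ • expQ I α) =
      (r * ρ) • (expQ I (α - θ) + expQ I (α + θ)) := by
    rw [h1]; module
  rw [h3, smul_mul_smul_comm, ← h2]
  simp only [sub_mul, mul_sub, smul_mul_smul_comm, one_mul, mul_one]
  module

lemma norm_one_sub_smul_expQ_le (hre : I.re = 0) (hn : ‖I‖ = 1) {a δ : ℝ} (ha : |a| ≤ 1) :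
    ‖1 - a • expQ I δ‖ ≤ (1 - a) + 2 * |δ| := by
  have hI : 1 - expQ I δ = (1 - Real.cos δ) • (1 : ℍ[ℝ]) + (-Real.sin δ) • I := by
    unfold expQ; module
  have hδ : ‖1 - expQ I δ‖ ≤ |δ| := by
    refine abs_le_of_sq_le_sq' ?_ (abs_nonneg δ) |>.2
    rw [hI, normSq_smul_one_add_smul hre hn, sq_abs]
    nlinarith [Real.one_sub_sq_div_two_le_cos (x := δ), Real.sin_sq_add_cos_sq δ]
  have h : 1 - a • expQ I δ = (1 - a) • (1 : ℍ[ℝ]) + a • (1 - expQ I δ) := by module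
  have ha' : 0 ≤ 1 - a := by linarith [le_abs_self a]
  rw [h]
  refine (norm_add_le _ _).trans ?_
  rw [norm_smul, norm_smul, norm_one, Real.norm_eq_abs, Real.norm_eq_abs, abs_of_nonneg ha']
  nlinarith [norm_nonneg (1 - expQ I δ), abs_nonneg a, abs_nonneg δ]

/-- The factor of the characteristic polynomial that may be away from zero is controlled by the
numerator of the averaged kernel. -/
lemma norm_one_sub_smul_expQ_add_le (hre : I.re = 0) (hn : ‖I‖ = 1) {r θ ρ α : ℝ}
    (hr : 3 / 4 ≤ r) (hr1 : r < 1) (hρ : 1 / 2 ≤ ρ) (hρ1 : ρ < 1)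
    (hα : 0 ≤ Real.sin α) (hθ : 0 ≤ Real.sin θ) (hδ : |α - θ| ≤ 1 - r) :
    ‖1 - (r * ρ) • expQ I (α + θ)‖ ≤ 8 * ‖1 - (r * Real.cos θ) • (ρ • expQ I α)‖ := by
  set A := ‖1 - (r * Real.cos θ) • (ρ • expQ I α)‖ with hA
  have hA0 : 0 ≤ A := norm_nonneg _
  have hsq : A ^ 2 = (1 - r * Real.cos θ * ρ * Real.cos α) ^ 2 +
      (r * Real.cos θ * ρ * Real.sin α) ^ 2 := by
    have : 1 - (r * Real.cos θ) • (ρ • expQ I α) =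
        (1 - r * Real.cos θ * ρ * Real.cos α) • (1 : ℍ[ℝ]) +
          (-(r * Real.cos θ * ρ * Real.sin α)) • I := by
      unfold expQ; module
    rw [hA, this, normSq_smul_one_add_smul hre hn, neg_sq]
  have hlow : 1 - r * ρ * |Real.cos θ| ≤ A := by
    have := norm_sub_norm_le (1 : ℍ[ℝ]) ((r * Real.cos θ) • (ρ • expQ I α))
    rw [norm_smul, norm_smul, norm_expQ hre hn, norm_one, Real.norm_eq_abs, Real.norm_eq_abs,
      abs_mul, abs_of_nonneg (show 0 ≤ r by linarith), abs_of_nonneg (show 0 ≤ ρ by linarith)]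
      at this
    linarith
  have hrρ : r * ρ ≤ r := by nlinarith
  have hsin : Real.sin θ ≤ 7 * A := by
    rcases le_total |Real.cos θ| (1 / 2) with hc | hc
    · nlinarith [Real.sin_le_one θ, abs_nonneg (Real.cos θ)]
    · have h1 : |r * Real.cos θ * ρ * Real.sin α| ≤ A :=
        abs_le_of_sq_le_sq (by nlinarith [sq_nonneg (1 - r * Real.cos θ * ρ * Real.cos α)]) hA0
      rw [abs_mul, abs_mul, abs_mul, abs_of_nonneg hα, abs_of_nonneg (show 0 ≤ r by linarith),
        abs_of_nonneg (show 0 ≤ ρ by linarith)] at h1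
      have h2 : 3 / 16 ≤ r * |Real.cos θ| * ρ := by
        have : 3 / 8 ≤ r * |Real.cos θ| := by nlinarith
        nlinarith
      have h3 : 3 / 16 * Real.sin α ≤ A := (mul_le_mul_of_nonneg_right h2 hα).trans h1
      have h4 : Real.sin θ - Real.sin α ≤ 1 - r := by
        have := Real.abs_sin_sub_sin_le θ α
        rw [abs_sub_comm θ α] at this
        exact (le_abs_self _).trans (this.trans hδ)
      have h5 : 1 - r ≤ A := by
        nlinarith [Real.abs_cos_le_one θ, abs_nonneg (Real.cos θ)]
      linarith
  have hsplit : 1 - (r * ρ) • expQ I (α + θ) =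
      (1 - (r * Real.cos θ) • (ρ • expQ I α)) -
        (r * ρ * Real.sin θ) • expQ I (α + Real.pi / 2) := by
    simp only [expQ, Real.cos_add, Real.sin_add, Real.cos_pi_div_two, Real.sin_pi_div_two]
    module
  rw [hsplit]
  refine (norm_sub_le _ _).trans ?_
  rw [norm_smul, norm_expQ hre hn, Real.norm_eq_abs,
    abs_of_nonneg (mul_nonneg (by nlinarith) hθ), ← hA]
  nlinarith

end ImaginaryUnit

lemma norm_mul_cos_thetaOf {w : ℍ[ℝ]} (hw : w ≠ 0) : ‖w‖ * Real.cos (thetaOf w) = w.re := by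
  have hpos : 0 < ‖w‖ := norm_pos_iff.mpr hw
  have h : |w.re| ≤ ‖w‖ := by
    refine abs_le_of_sq_le_sq ?_ hpos.le
    rw [sq ‖w‖, ← Quaternion.normSq_eq_norm_mul_self, Quaternion.normSq_def']
    nlinarith [sq_nonneg w.imI, sq_nonneg w.imJ, sq_nonneg w.imK]
  rw [abs_le] at h
  rw [thetaOf, Real.cos_arccos]
  · field_simp
  · rw [le_div_iff₀ hpos]; linarith
  · rw [div_le_iff₀ hpos]; linarith

/-- **Lower bound for the averaged kernel on symmetric boxes.**
There is a constant `c > 0` such that for every `w ∈ 𝔹 \ {0}` and every `q` in the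
symmetric box `S(w)`, `|(1/2)(k_w(q) + k_{w̄}(q))| ≥ c/(1 − |w|²)`. -/
theorem averaged_kernel_lower_bound :
    ∃ c : ℝ, 0 < c ∧ ∀ w : ℍ[ℝ], w ≠ 0 → ‖w‖ < 1 → ∀ q ∈ symmBox w,
      c / (1 - ‖w‖ ^ 2) ≤ ‖(1 / 2 : ℝ) • (hardyKernel w q + hardyKernel (star w) q)‖ := by
  refine ⟨1 / 64, by norm_num, ?_⟩
  rintro w hw0 hw q ⟨hq, I, α, ρ, hre, hn, hα, hδ, hρ0, hρ, hqe⟩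
  have hchar := congrArg norm (charpoly_mul_average hq hw)
  rw [norm_mul] at hchar
  set g := ‖(1 / 2 : ℝ) • (hardyKernel w q + hardyKernel (star w) q)‖
  have hg : 0 ≤ g := norm_nonneg _
  have hr0 : 0 < ‖w‖ := norm_pos_iff.mpr hw0
  have hcos := norm_mul_cos_thetaOf hw0
  have hsin : 0 ≤ Real.sin (thetaOf w) :=
    Real.sin_nonneg_of_nonneg_of_le_pi (Real.arccos_nonneg _) (Real.arccos_le_pi _)
  have hqρ : |ρ| < 1 := by
    rwa [hqe, norm_smul, norm_expQ hre hn, mul_one, Real.norm_eq_abs] at hq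
  have hwρ : |‖w‖ * ρ| ≤ ‖w‖ := by
    rw [abs_mul, abs_of_pos hr0]
    exact mul_le_of_le_one_right hr0.le hqρ.le
  rw [← hcos, hqe, charpoly_expQ_eq hre hn, norm_mul] at hchar
  have hnum : 1 - ‖w‖ ≤ ‖1 - (‖w‖ * Real.cos (thetaOf w)) • (ρ • expQ I α)‖ := by
    have h := norm_sub_norm_le (1 : ℍ[ℝ]) ((‖w‖ * Real.cos (thetaOf w)) • (ρ • expQ I α))
    rw [norm_smul, norm_smul, norm_expQ hre hn, norm_one, Real.norm_eq_abs, Real.norm_eq_abs,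
      abs_mul, abs_of_pos hr0, mul_one] at h
    have h1 : |Real.cos (thetaOf w)| * |ρ| ≤ 1 :=
      mul_le_one₀ (Real.abs_cos_le_one _) (abs_nonneg _) hqρ.le
    nlinarith
  rw [div_le_iff₀ (by nlinarith)]
  suffices h : 1 / 64 ≤ g * (1 - ‖w‖) by nlinarith
  rcases le_total (3 / 4) ‖w‖ with hr | hr
  · have h1 : ‖1 - (‖w‖ * ρ) • expQ I (α - thetaOf w)‖ ≤ 5 * (1 - ‖w‖) := by
      refine (norm_one_sub_smul_expQ_le hre hn (hwρ.trans hw.le)).trans ?_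
      nlinarith
    have h2 := norm_one_sub_smul_expQ_add_le (θ := thetaOf w) (ρ := ρ) hre hn hr hw
      (by linarith) (by linarith) (Real.sin_nonneg_of_nonneg_of_le_pi hα.1 hα.2) hsin hδ
    set A := ‖1 - (‖w‖ * Real.cos (thetaOf w)) • (ρ • expQ I α)‖
    have hA : 0 < A := by linarith
    have h3 : A ≤ 5 * (1 - ‖w‖) * (8 * A) * g := by
      refine hchar.ge.trans ?_
      gcongr
    have h4 : 1 * A ≤ (40 * (g * (1 - ‖w‖))) * A := by linarith
    have h5 := le_of_mul_le_mul_right h4 hA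
    linarith
  · have h (β : ℝ) : ‖1 - (‖w‖ * ρ) • expQ I β‖ ≤ 2 := by
      refine (norm_sub_le _ _).trans ?_
      rw [norm_smul, norm_expQ hre hn, norm_one, Real.norm_eq_abs]
      linarith
    have h1 : 1 - ‖w‖ ≤ 2 * 2 * g := by
      refine (hnum.trans hchar.ge).trans ?_
      gcongr <;> exact h _
    nlinarith
end
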